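/- arXiv:2503.15381 — 10 statements merged into one kernel-verified Lean document; each statement's English description precedes it below -/
import Mathlib

section
/- Specker's theorem: for every natural number n, ω² → (ω², n)². That is, for every 2-coloring of the linear order ω² (the lexicographic order on ℕ × ℕ), either there is a subset order-isomorphic to ω² all of whose pairs are red, or there is a set of n elements all of whose pairs are blue. -/
open Filter in
/-- **Infinite Ramsey theorem.** A finite coloring of the strictly decreasing `r`-tuples of natural
numbers is constant on the tuples from the range of some strictly increasing sequence. -/
theorem exists_strictMono_forall_map_eq {C : Type*} [Finite C] (r : ℕ) (f : List ℕ → C) :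
    ∃ h : ℕ → ℕ, StrictMono h ∧ ∃ c, ∀ l : List ℕ, l.length = r → l.Pairwise (· > ·) →
      f (l.map h) = c := by
  have hlim (g : ℕ → C) : ∃ c, ∀ᶠ x in (hyperfilter ℕ : Filter ℕ), g x = c := by
    obtain ⟨c, hc⟩ := ((hyperfilter ℕ).map g).eq_pure_of_finite
    refine ⟨c, ?_⟩
    have : {c} ∈ (hyperfilter ℕ).map g := by rw [hc]; exact Ultrafilter.mem_pure.2 rfl
    exact this
  choose lim hlim using hlim
  -- `F k l` is the iterated limit color of the extensions of `l` by `k` further elements.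
  let F : ℕ → List ℕ → C := fun k => k.rec f fun _ g l => lim fun x => g (x :: l)
  let G : List ℕ → C := fun l => F (r - l.length) l
  have hG (l : List ℕ) (hl : l.length < r) :
      ∀ᶠ x in (hyperfilter ℕ : Filter ℕ), G (x :: l) = G l := by
    obtain ⟨k, hk⟩ : ∃ k, r - l.length = k + 1 := ⟨r - l.length - 1, by omega⟩
    have hk' : r - (l.length + 1) = k := by omega
    simp only [G, List.length_cons, hk, hk']
    exact hlim fun x => F k (x :: l)
  have hnext (L : List ℕ) : ∃ x, (∀ y ∈ L, y < x) ∧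
      ∀ l, l.Sublist L → l.length < r → G (x :: l) = G l := by
    have h₁ : ∀ᶠ x in (hyperfilter ℕ : Filter ℕ), ∀ y ∈ L.toFinset, y < x := by
      rw [eventually_all_finset]
      exact fun y _ => (Nat.cofinite_eq_atTop ▸ hyperfilter_le_cofinite :
        (hyperfilter ℕ : Filter ℕ) ≤ atTop) (eventually_gt_atTop y)
    have h₂ : ∀ᶠ x in (hyperfilter ℕ : Filter ℕ),
        ∀ l ∈ L.sublists.toFinset, l.length < r → G (x :: l) = G l := by
      rw [eventually_all_finset]
      exact fun l _ => eventually_imp_distrib_left.2 (hG l)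
    obtain ⟨x, hx₁, hx₂⟩ := (h₁.and h₂).exists
    exact ⟨x, by simpa using hx₁, by simpa using hx₂⟩
  choose p hp_lt hpG using hnext
  let L : ℕ → List ℕ := fun n => n.rec [] fun _ l => p l :: l
  have hL (n : ℕ) : L (n + 1) = p (L n) :: L n := rfl
  have hL_mono {m n : ℕ} (hmn : m ≤ n) : (L m).Sublist (L n) := by
    induction n, hmn using Nat.le_induction with
    | base => exact List.Sublist.refl _
    | succ n _ ih => exact ih.trans (List.sublist_cons_self _ _)
  have hL_const (n : ℕ) : ∀ l, l.Sublist (L n) → l.length ≤ r → G l = G [] := by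
    induction n with
    | zero => intro l hl _; rw [List.sublist_nil.1 hl]
    | succ n ih =>
      intro l hl hlr
      rw [hL, List.sublist_cons_iff] at hl
      obtain hl | ⟨l, rfl, hl⟩ := hl
      · exact ih l hl hlr
      · rw [List.length_cons] at hlr
        rw [hpG _ _ hl (by omega), ih l hl (by omega)]
  have hsub : ∀ (l : List ℕ) (n : ℕ), l.Pairwise (· > ·) → (∀ a ∈ l, a < n) →
      (l.map fun k => p (L k)).Sublist (L n) := by
    intro l
    induction l with
    | nil => simp
    | cons a l ih =>
      intro n hl hn
      rw [List.pairwise_cons] at hl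
      exact ((ih a hl.2 hl.1).cons_cons _).trans (hL_mono (hn a List.mem_cons_self))
  refine ⟨fun k => p (L k), strictMono_nat_of_lt_succ fun n => hp_lt _ _ List.mem_cons_self,
    G [], fun l hlr hl => ?_⟩
  rw [← hL_const (l.sum + 1) _ (hsub l _ hl fun a ha => Nat.lt_succ_of_le (List.le_sum_of_mem ha))
    (by simp [hlr])]
  simp [G, F, hlr]

theorem exists_finset_card_eq_of_strictMono {α : Type*} [Preorder α] (c : α → α → Bool)
    (n : ℕ) (g : ℕ → α) (hg : StrictMono g)
    (hc : ∀ i j, i < j → j < n → c (g i) (g j) = false) :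
    ∃ s : Finset α, s.card = n ∧ ∀ x ∈ s, ∀ y ∈ s, x < y → c x y = false := by
  refine ⟨(Finset.range n).map ⟨g, hg.injective⟩, by simp, ?_⟩
  simp only [Finset.mem_map, Finset.mem_range]
  rintro _ ⟨i, _, rfl⟩ _ ⟨j, hj, rfl⟩ hij
  exact hc i j (hg.lt_iff_lt.1 hij) hj

/-- The colors of the pairs of points of `ℕ ×ₗ ℕ` whose coordinates are the entries of a strictly
decreasing list `[z, y, x, w]`. -/
def coordinateColors (c : ℕ ×ₗ ℕ → ℕ ×ₗ ℕ → Bool) : List ℕ → Bool × Bool × Bool × Bool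
  | [z, y, x, w] =>
    (c (toLex (w, x)) (toLex (w, y)), c (toLex (w, x)) (toLex (y, z)),
      c (toLex (w, y)) (toLex (x, z)), c (toLex (w, z)) (toLex (x, y)))
  | _ => default

/-- **Specker's theorem:** `ω² → (ω², n)²` for every `n : ℕ`. Here `ω²` is the
lexicographic order on `ℕ × ℕ`; a coloring assigns red (`true`) or blue
(`false`) to each increasing pair. Either there is a copy of `ω²` (the range of
an order embedding) all of whose pairs are red, or a set of `n` elements all of
whose pairs are blue. -/
theorem specker (n : ℕ) :
    ∀ c : ℕ ×ₗ ℕ → ℕ ×ₗ ℕ → Bool,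
      (∃ e : ℕ ×ₗ ℕ ↪o ℕ ×ₗ ℕ,
        ∀ a b : ℕ ×ₗ ℕ, a < b → c (e a) (e b) = true) ∨
      (∃ s : Finset (ℕ ×ₗ ℕ), s.card = n ∧
        ∀ x ∈ s, ∀ y ∈ s, x < y → c x y = false) := by
  intro c
  obtain ⟨h, hh, ⟨c₁, c₂, c₃, c₄⟩, hc⟩ := exists_strictMono_forall_map_eq 4 (coordinateColors c)
  have key (w x y z : ℕ) (hwx : w < x) (hxy : x < y) (hyz : y < z) :
      c (toLex (h w, h x)) (toLex (h w, h y)) = c₁ ∧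
      c (toLex (h w, h x)) (toLex (h y, h z)) = c₂ ∧
      c (toLex (h w, h y)) (toLex (h x, h z)) = c₃ ∧
      c (toLex (h w, h z)) (toLex (h x, h y)) = c₄ := by
    have := hc [z, y, x, w] rfl (by simp; omega)
    simpa [coordinateColors] using this
  have hlt {a b a' b' : ℕ} (hab : a < a' ∨ a = a' ∧ b < b') :
      toLex (h a, h b) < toLex (h a', h b') := by
    rw [Prod.Lex.toLex_lt_toLex]
    simpa [hh.lt_iff_lt, hh.injective.eq_iff] using hab
  cases c₁ with
  | false =>
    exact .inr <| exists_finset_card_eq_of_strictMono c n (fun i => toLex (h 0, h (i + 1)))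
      (fun i j hij => hlt (by omega)) fun i j hij _ =>
        (key 0 (i + 1) (j + 1) (j + 2) (by omega) (by omega) (by omega)).1
  | true =>
  cases c₂ with
  | false =>
    exact .inr <| exists_finset_card_eq_of_strictMono c n
      (fun i => toLex (h (2 * i), h (2 * i + 1)))
      (fun i j hij => hlt (by omega)) fun i j hij _ =>
        (key (2 * i) (2 * i + 1) (2 * j) (2 * j + 1) (by omega) (by omega) (by omega)).2.1
  | true =>
  cases c₃ with
  | false =>
    exact .inr <| exists_finset_card_eq_of_strictMono c n (fun i => toLex (h i, h (n + i)))
      (fun i j hij => hlt (by omega)) fun i j hij _ =>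
        (key i j (n + i) (n + j) (by omega) (by omega) (by omega)).2.2.1
  | true =>
  cases c₄ with
  | false =>
    exact .inr <| exists_finset_card_eq_of_strictMono c n (fun i => toLex (h i, h (2 * n - i)))
      (fun i j hij => hlt (by omega)) fun i j hij _ =>
        (key i j (2 * n - j) (2 * n - i) (by omega) (by omega) (by omega)).2.2.2
  | true =>
  left
  let e : ℕ ×ₗ ℕ → ℕ ×ₗ ℕ := fun a =>
    toLex (h (2 * (ofLex a).1), h (2 * Nat.pair (ofLex a).1 (ofLex a).2 + 1))
  have he : StrictMono e := by
    intro a b hab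
    rw [Prod.Lex.lt_iff] at hab
    refine hlt ?_
    obtain hab | ⟨h₁, h₂⟩ := hab
    · omega
    · rw [h₁]
      have := Nat.pair_lt_pair_right (ofLex b).1 h₂
      omega
  refine ⟨OrderEmbedding.ofStrictMono e he, fun a b hab => ?_⟩
  change c (e a) (e b) = true
  obtain ⟨⟨i, j⟩, rfl⟩ := toLex.surjective a
  obtain ⟨⟨i', j'⟩, rfl⟩ := toLex.surjective b
  simp only [Prod.Lex.toLex_lt_toLex] at hab
  simp only [e, ofLex_toLex]
  have hi := Nat.left_le_pair i j
  have hi' := Nat.left_le_pair i' j'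
  obtain hab | ⟨rfl, hab⟩ := hab
  · have hne : Nat.pair i j ≠ Nat.pair i' j' := fun H => hab.ne (Nat.pair_eq_pair.1 H).1
    generalize Nat.pair i j = p at *
    generalize Nat.pair i' j' = q at *
    rcases lt_or_ge (2 * p + 1) (2 * i') with hpi | hpi
    · exact (key (2 * i) (2 * p + 1) (2 * i') (2 * q + 1)
        (by omega) (by omega) (by omega)).2.1
    · rcases hne.lt_or_gt with hpq | hpq
      · exact (key (2 * i) (2 * i') (2 * p + 1) (2 * q + 1)
          (by omega) (by omega) (by omega)).2.2.1
      · exact (key (2 * i) (2 * i') (2 * q + 1) (2 * p + 1)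
          (by omega) (by omega) (by omega)).2.2.2
  · have := Nat.pair_lt_pair_right i hab
    exact (key (2 * i) (2 * Nat.pair i j + 1) (2 * Nat.pair i j' + 1) (2 * Nat.pair i j' + 2)
      (by omega) (by omega) (by omega)).1
end

section
/- If A and B are indecomposable linear orders, then the product A·B (the lexicographic order on B × A) is indecomposable. -/
/-- A linear order `L` is *indecomposable* if for every partition of `L` into
two sets, at least one of the two sets contains a copy of `L` (the range of an
order embedding of `L` into that set with its induced order). -/
def Indecomposable' (L : Type*) [LinearOrder L] : Prop :=
  ∀ A B : Set L, A ∪ B = Set.univ →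
    Nonempty (L ↪o A) ∨ Nonempty (L ↪o B)

/-- If `B` embeds into the set of those `b` for which `A` embeds into the fiber of `S` over `b`,
then `B ×ₗ A` embeds into `S`. -/
theorem nonempty_lex_orderEmbedding_of_fibers {A B : Type*} [LinearOrder A] [LinearOrder B]
    {S : Set (B ×ₗ A)}
    (f : B ↪o {b : B | Nonempty (A ↪o {a : A | toLex (b, a) ∈ S})}) :
    Nonempty (B ×ₗ A ↪o S) := by
  let g (b : B) : A ↪o {a : A | toLex ((f b : B), a) ∈ S} := (f b).2.some
  refine ⟨OrderEmbedding.ofStrictMono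
    (fun p => ⟨toLex ((f (ofLex p).1 : B), (g (ofLex p).1 (ofLex p).2 : A)),
      (g (ofLex p).1 (ofLex p).2).2⟩) ?_⟩
  intro p q h
  rw [← Subtype.coe_lt_coe, Prod.Lex.toLex_lt_toLex]
  rcases Prod.Lex.lt_iff.1 h with h | ⟨h₁, h₂⟩
  · exact Or.inl (f.strictMono h)
  · dsimp only
    rw [← h₁]
    exact Or.inr ⟨rfl, (g _).strictMono h₂⟩

/-- If `A` and `B` are indecomposable linear orders, then so is the product
`A·B`, i.e. the lexicographic order on `B × A`. -/
theorem indecomposable_lex_prod {A B : Type*} [LinearOrder A] [LinearOrder B]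
    (hA : Indecomposable' A) (hB : Indecomposable' B) :
    Indecomposable' (B ×ₗ A) := by
  intro S T hST
  have hfiber : {b : B | Nonempty (A ↪o {a : A | toLex (b, a) ∈ S})} ∪
      {b : B | Nonempty (A ↪o {a : A | toLex (b, a) ∈ T})} = Set.univ :=
    Set.eq_univ_of_forall fun b => hA _ _ <|
      Set.eq_univ_of_forall fun a => Set.eq_univ_iff_forall.1 hST (toLex (b, a))
  exact (hB _ _ hfiber).imp (fun ⟨f⟩ => nonempty_lex_orderEmbedding_of_fibers f)
    (fun ⟨f⟩ => nonempty_lex_orderEmbedding_of_fibers f)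
end

section
/- If a linear order L satisfies L → (ω, ω*)¹, then L contains a copy of ω·ω* (the lexicographic order on ℕᵒᵈ × ℕ) or a copy of ω*·ω (the lexicographic order on ℕ × ℕᵒᵈ). -/
/-- `L → (ω, ω*)¹`: for every partition of `L` into two sets, the first
contains a copy of `ω` or the second contains a copy of `ω*`. -/
def ArrowOmegaOmegaStar (L : Type*) [LinearOrder L] : Prop :=
  ∀ A B : Set L, A ∪ B = Set.univ →
    Nonempty (ℕ ↪o A) ∨ Nonempty (ℕᵒᵈ ↪o B)

open Set

/-- If no final segment `D ∩ [y, ∞)` of a nonempty set `D` is well-ordered, then `D` contains an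
increasing sequence of decreasing sequences. -/
theorem exists_strictAnti_blocks {L : Type*} [LinearOrder L] {D : Set L} (hD : D.Nonempty)
    (h : ∀ y ∈ D, ¬ (D ∩ Ici y).IsWF) :
    ∃ f : ℕ → ℕ → L, (∀ n, StrictAnti (f n)) ∧ ∀ n m, n < m → ∀ i j, f n i < f m j := by
  have key : ∀ y : D, ∃ s : ℕ → D, StrictAnti s ∧ ∀ n, y < s n := by
    intro y
    have hy := h y y.2
    rw [Set.IsWF, wellFoundedOn_iff_no_descending_seq] at hy
    push Not at hy
    obtain ⟨s, hs⟩ := hy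
    have hs' : StrictAnti fun n => (⟨s n, (hs n).1⟩ : D) := fun a b hab =>
      s.map_rel_iff.2 hab
    exact ⟨_, hs', fun n => (show y ≤ _ from (hs (n + 1)).2).trans_lt
      (hs' n.lt_succ_self)⟩
  choose g hg hlt using key
  obtain ⟨x, hx⟩ := hD
  let y : ℕ → D := fun n => (fun z => g z 0)^[n] ⟨x, hx⟩
  have hy : ∀ n, y (n + 1) = g (y n) 0 := fun n => Function.iterate_succ_apply' _ _ _
  have hmono : StrictMono y := strictMono_nat_of_lt_succ fun n => by
    rw [hy]; exact hlt _ _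
  refine ⟨fun n i => g (y n) i, fun n a b hab => hg (y n) hab, fun n m hnm i j => ?_⟩
  have h₁ : g (y n) i ≤ y (n + 1) := by
    rw [hy]; exact (hg (y n)).antitone i.zero_le
  exact (h₁.trans (hmono.monotone hnm)).trans_lt (hlt (y m) j)

theorem exists_isWF_inter_Ici {L : Type*} [LinearOrder L] (hL : IsEmpty (ℕ ×ₗ ℕᵒᵈ ↪o L))
    {D : Set L} (hD : D.Nonempty) : ∃ y ∈ D, (D ∩ Ici y).IsWF := by
  by_contra! h
  obtain ⟨f, hf, hlt⟩ := exists_strictAnti_blocks hD h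
  refine hL.false (OrderEmbedding.ofStrictMono
    (fun p : ℕ ×ₗ ℕᵒᵈ => f (ofLex p).1 (OrderDual.ofDual (ofLex p).2)) fun p q hpq => ?_)
  obtain hpq | ⟨h₁, h₂⟩ := Prod.Lex.lt_iff.1 hpq
  · exact hlt _ _ hpq _ _
  · simp only [h₁]
    exact hf _ h₂

theorem exists_wellFoundedOn_gt_inter_Iic {L : Type*} [LinearOrder L]
    (hL : IsEmpty (ℕᵒᵈ ×ₗ ℕ ↪o L)) {U : Set L} (hU : U.Nonempty) :
    ∃ y ∈ U, (U ∩ Iic y).WellFoundedOn (· > ·) := by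
  by_contra! h
  obtain ⟨f, hf, hlt⟩ := exists_strictAnti_blocks (L := Lᵒᵈ)
    (D := OrderDual.ofDual ⁻¹' U) hU h
  refine hL.false (OrderEmbedding.ofStrictMono
    (fun p : ℕᵒᵈ ×ₗ ℕ => OrderDual.ofDual (f (OrderDual.ofDual (ofLex p).1) (ofLex p).2))
    fun p q hpq => ?_)
  obtain hpq | ⟨h₁, h₂⟩ := Prod.Lex.lt_iff.1 hpq
  · exact hlt _ _ hpq _ _
  · simp only [h₁]
    exact hf _ h₂

/-- A set covered by a reverse well-ordered set and a well-ordered set. -/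
def IsWFCovered {L : Type*} [LinearOrder L] (S : Set L) : Prop :=
  ∃ A B : Set L, A.WellFoundedOn (· > ·) ∧ B.IsWF ∧ S ⊆ A ∪ B

namespace IsWFCovered

variable {L : Type*} [LinearOrder L] {S T : Set L}

theorem mono (hT : IsWFCovered T) (h : S ⊆ T) : IsWFCovered S :=
  let ⟨A, B, hA, hB, hAB⟩ := hT
  ⟨A, B, hA, hB, h.trans hAB⟩

theorem of_isWF (hS : S.IsWF) : IsWFCovered S :=
  ⟨∅, S, wellFoundedOn_empty _, hS, subset_union_right⟩

theorem of_wellFoundedOn_gt (hS : S.WellFoundedOn (· > ·)) : IsWFCovered S :=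
  ⟨S, ∅, hS, isWF_empty, subset_union_left⟩

theorem union (hS : IsWFCovered S) (hT : IsWFCovered T) : IsWFCovered (S ∪ T) := by
  obtain ⟨A, B, hA, hB, hAB⟩ := hS
  obtain ⟨A', B', hA', hB', hAB'⟩ := hT
  refine ⟨A ∪ A', B ∪ B', hA.union hA', hB.union hB', ?_⟩
  rw [union_union_union_comm]
  exact union_subset_union hAB hAB'

end IsWFCovered

theorem isWFCovered_univ {L : Type*} [LinearOrder L] (h₁ : IsEmpty (ℕᵒᵈ ×ₗ ℕ ↪o L))
    (h₂ : IsEmpty (ℕ ×ₗ ℕᵒᵈ ↪o L)) : IsWFCovered (univ : Set L) := by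
  let D : Set L := {y | IsWFCovered (Iic y)}
  have hD : IsWFCovered D := by
    rcases D.eq_empty_or_nonempty with h | h
    · exact h ▸ .of_isWF isWF_empty
    · obtain ⟨y, hy, hwf⟩ := exists_isWF_inter_Ici h₂ h
      exact (IsWFCovered.union hy (.of_isWF hwf)).mono fun z hz =>
        (le_total z y).imp id fun hyz => ⟨hz, hyz⟩
  rcases Dᶜ.eq_empty_or_nonempty with h | h
  · exact compl_empty_iff.1 h ▸ hD
  · obtain ⟨z, hz, hwf⟩ := exists_wellFoundedOn_gt_inter_Iic h₁ h
    exact absurd ((hD.union (.of_wellFoundedOn_gt hwf)).mono fun w hw =>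
      (em (w ∈ D)).imp id fun hwD => ⟨hwD, hw⟩) hz

/-- If `L → (ω, ω*)¹`, then `L` contains a copy of `ω·ω*` (the lexicographic
order on `ℕᵒᵈ × ℕ`) or a copy of `ω*·ω` (the lexicographic order on
`ℕ × ℕᵒᵈ`). -/
theorem contains_copy_of_arrowOmegaOmegaStar {L : Type*} [LinearOrder L]
    (hL : ArrowOmegaOmegaStar L) :
    Nonempty (ℕᵒᵈ ×ₗ ℕ ↪o L) ∨ Nonempty (ℕ ×ₗ ℕᵒᵈ ↪o L) := by
  by_contra! h
  obtain ⟨A, B, hA, hB, hAB⟩ := isWFCovered_univ h.1 h.2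
  rcases hL A B (univ_subset_iff.1 hAB) with ⟨⟨e⟩⟩ | ⟨⟨e⟩⟩
  · rw [wellFoundedOn_iff_no_descending_seq] at hA
    refine hA ⟨⟨fun n => e n, fun a b hab => e.injective (Subtype.ext hab)⟩,
      fun {a b} => e.lt_iff_lt⟩ ?_
    exact fun n => (e n).2
  · rw [Set.IsWF, wellFoundedOn_iff_no_descending_seq] at hB
    refine hB ⟨⟨fun n => e (OrderDual.toDual n), fun a b hab => e.injective (Subtype.ext hab)⟩,
      fun {a b} => e.lt_iff_lt⟩ ?_
    exact fun n => (e _).2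
end

section
/- The following are equivalent for a linear order L: (1) L → (ℤ, ℤ)¹, i.e., for every partition of L into two sets, at least one set contains a copy of ℤ; (2) L → (ω, ω*)¹; (3) L contains a copy of ω·ω* (the lexicographic order on ℕᵒᵈ × ℕ) or a copy of ω*·ω (the lexicographic order on ℕ × ℕᵒᵈ). -/
/-- `L → (ℤ, ℤ)¹`: for every partition of `L` into two sets, at least one of
the sets contains a copy of `ℤ`. -/
def ArrowZZ (L : Type*) [LinearOrder L] : Prop :=
  ∀ A B : Set L, A ∪ B = Set.univ →
    Nonempty (ℤ ↪o A) ∨ Nonempty (ℤ ↪o B)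

/-- A set covered by a well-ordered set and a reversely well-ordered set. -/
def CoveredByWFs {L : Type*} [LinearOrder L] (S : Set L) : Prop :=
  ∃ A B : Set L, S ⊆ A ∪ B ∧ A.IsWF ∧ (OrderDual.ofDual ⁻¹' B).IsWF

namespace CoveredByWFs

variable {L : Type*} [LinearOrder L] {S T : Set L}

theorem mono (hT : CoveredByWFs T) (h : S ⊆ T) : CoveredByWFs S := by
  obtain ⟨A, B, hAB, hA, hB⟩ := hT
  exact ⟨A, B, h.trans hAB, hA, hB⟩

theorem union (hS : CoveredByWFs S) (hT : CoveredByWFs T) : CoveredByWFs (S ∪ T) := by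
  obtain ⟨A, B, hAB, hA, hB⟩ := hS
  obtain ⟨A', B', hAB', hA', hB'⟩ := hT
  refine ⟨A ∪ A', B ∪ B', ?_, hA.union hA', hB.union hB'⟩
  rintro x (hx | hx)
  · rcases hAB hx with h | h <;> simp [h]
  · rcases hAB' hx with h | h <;> simp [h]

theorem of_isWF (hS : S.IsWF) : CoveredByWFs S :=
  ⟨S, ∅, by simp, hS, by simp⟩

theorem dual (hS : CoveredByWFs S) : CoveredByWFs (OrderDual.ofDual ⁻¹' S : Set Lᵒᵈ) := by
  obtain ⟨A, B, hAB, hA, hB⟩ := hS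
  refine ⟨OrderDual.ofDual ⁻¹' B, OrderDual.ofDual ⁻¹' A, ?_, hB, hA⟩
  intro x hx
  exact (hAB hx).symm

end CoveredByWFs

section Embeddings

variable {L : Type*} [LinearOrder L]

theorem nonempty_prodLex_embedding (e : ℕ → ℕ → L) (hanti : ∀ k, StrictAnti (e k))
    (hlt : ∀ k n m, e k n < e (k + 1) m) : Nonempty (ℕ ×ₗ ℕᵒᵈ ↪o L) := by
  have hlt' : ∀ k k', k < k' → ∀ n m, e k n < e k' m := by
    intro k k' h
    induction k', h using Nat.le_induction with
    | base => exact hlt k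
    | succ j _ ih => exact fun n m => (ih n 0).trans (hlt j 0 m)
  refine ⟨OrderEmbedding.ofStrictMono
    (fun p => e (ofLex p).1 (OrderDual.ofDual (ofLex p).2)) ?_⟩
  intro p q hpq
  rcases Prod.Lex.lt_iff.1 hpq with h | ⟨h, h'⟩
  · exact hlt' _ _ h _ _
  · dsimp only
    rw [h]
    exact hanti _ h'

theorem nonempty_prodLex_embedding_of_dual (h : Nonempty (ℕ ×ₗ ℕᵒᵈ ↪o Lᵒᵈ)) :
    Nonempty (ℕᵒᵈ ×ₗ ℕ ↪o L) := by
  obtain ⟨f⟩ := h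
  refine ⟨OrderEmbedding.ofStrictMono (fun p => OrderDual.ofDual
    (f (toLex (OrderDual.ofDual (ofLex p).1, OrderDual.toDual (ofLex p).2)))) ?_⟩
  intro p q hpq
  refine OrderDual.ofDual_lt_ofDual.2 (f.strictMono (Prod.Lex.lt_iff.2 ?_))
  rcases Prod.Lex.lt_iff.1 hpq with h | ⟨h, h'⟩
  · exact Or.inl h
  · exact Or.inr ⟨congrArg OrderDual.ofDual h.symm, h'⟩

theorem nonempty_prodLex_dual_embedding (h : Nonempty (ℕᵒᵈ ×ₗ ℕ ↪o L)) :
    Nonempty (ℕ ×ₗ ℕᵒᵈ ↪o Lᵒᵈ) := by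
  obtain ⟨f⟩ := h
  refine ⟨OrderEmbedding.ofStrictMono (fun p => OrderDual.toDual
    (f (toLex (OrderDual.toDual (ofLex p).1, OrderDual.ofDual (ofLex p).2)))) ?_⟩
  intro p q hpq
  refine OrderDual.toDual_lt_toDual.2 (f.strictMono (Prod.Lex.lt_iff.2 ?_))
  rcases Prod.Lex.lt_iff.1 hpq with h | ⟨h, h'⟩
  · exact Or.inl h
  · exact Or.inr ⟨congrArg OrderDual.toDual h.symm, h'⟩

theorem nonempty_int_embedding (u d : ℕ → L) (hu : StrictMono u) (hd : StrictAnti d)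
    (h : d 0 < u 0) : Nonempty (ℤ ↪o L) := by
  refine ⟨OrderEmbedding.ofStrictMono
    (fun z => if 0 ≤ z then u z.toNat else d (-z).toNat) (strictMono_int_of_lt_succ ?_)⟩
  intro z
  split_ifs with h₁ h₂ h₂
  · exact hu (by omega)
  · omega
  · calc d (-z).toNat ≤ d 0 := hd.antitone (Nat.zero_le _)
      _ < u 0 := h
      _ ≤ u (z + 1).toNat := hu.monotone (Nat.zero_le _)
  · exact hd (by omega)

theorem nonempty_int_embedding_subtype (f : ℕ ×ₗ ℕᵒᵈ ↪o L) (A : Set L)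
    (hA : {k : ℕ | {n : ℕ | f (toLex (k, OrderDual.toDual n)) ∈ A}.Infinite}.Infinite) :
    Nonempty (ℤ ↪o A) := by
  obtain ⟨k₀, hk₀⟩ := hA.nonempty
  have hK : ∀ i, ∃ k > i, ∃ n : ℕ, f (toLex (k, OrderDual.toDual n)) ∈ A := by
    intro i
    obtain ⟨k, hk, hik⟩ := hA.exists_gt i
    exact ⟨k, hik, hk.nonempty⟩
  choose next hnext n hn using hK
  let k : ℕ → ℕ := fun i => next^[i] k₀
  have hk : ∀ i, k (i + 1) = next (k i) := fun i => Function.iterate_succ_apply' next i k₀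
  let u : ℕ → A := fun i => ⟨_, hn (k i)⟩
  let d : ℕ → A := fun i => ⟨_, Nat.nth_mem_of_infinite hk₀ i⟩
  refine nonempty_int_embedding u d (strictMono_nat_of_lt_succ fun i => ?_) (fun i j hij => ?_) ?_
  · refine Subtype.mk_lt_mk.2 (f.strictMono (Prod.Lex.lt_iff.2 (Or.inl ?_)))
    change next (k i) < next (k (i + 1))
    rw [hk i]
    exact hnext _
  · exact Subtype.mk_lt_mk.2 (f.strictMono (Prod.Lex.lt_iff.2
      (Or.inr ⟨rfl, OrderDual.toDual_lt_toDual.2 (Nat.nth_strictMono hk₀ hij)⟩)))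
  · exact Subtype.mk_lt_mk.2 (f.strictMono (Prod.Lex.lt_iff.2 (Or.inl (hnext k₀))))

theorem ArrowZZ.of_embedding (f : ℕ ×ₗ ℕᵒᵈ ↪o L) : ArrowZZ L := by
  intro A B hAB
  have hcover : ∀ k, {n : ℕ | f (toLex (k, OrderDual.toDual n)) ∈ A}.Infinite ∨
      {n : ℕ | f (toLex (k, OrderDual.toDual n)) ∈ B}.Infinite := by
    intro k
    rw [← Set.infinite_union]
    convert Set.infinite_univ (α := ℕ)
    refine Set.eq_univ_of_forall fun n => ?_
    exact hAB.ge (Set.mem_univ (f (toLex (k, OrderDual.toDual n))))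
  refine (Set.infinite_union.1 (Set.infinite_univ.mono fun k _ => hcover k)).imp
    (nonempty_int_embedding_subtype f A) (nonempty_int_embedding_subtype f B)

theorem ArrowZZ.of_dual (h : ArrowZZ Lᵒᵈ) : ArrowZZ L := by
  have aux : ∀ A : Set L, Nonempty (ℤ ↪o (OrderDual.ofDual ⁻¹' A : Set Lᵒᵈ)) →
      Nonempty (ℤ ↪o A) := by
    rintro A ⟨g⟩
    refine ⟨OrderEmbedding.ofStrictMono
      (fun z => ⟨OrderDual.ofDual (g (-z)).1, (g (-z)).2⟩) fun x y hxy => ?_⟩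
    have : g (-y) < g (-x) := g.strictMono (neg_lt_neg hxy)
    exact this
  intro A B hAB
  refine (h (OrderDual.ofDual ⁻¹' A) (OrderDual.ofDual ⁻¹' B) ?_).imp (aux A) (aux B)
  rw [← Set.preimage_union, hAB, Set.preimage_univ]

theorem ArrowZZ.arrowOmegaOmegaStar (h : ArrowZZ L) : ArrowOmegaOmegaStar L := by
  intro A B hAB
  refine (h A B hAB).imp ?_ ?_
  · rintro ⟨f⟩
    exact ⟨(OrderEmbedding.ofStrictMono (fun n : ℕ => (n : ℤ)) Nat.strictMono_cast).trans f⟩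
  · rintro ⟨f⟩
    refine ⟨(OrderEmbedding.ofStrictMono
      (fun n : ℕᵒᵈ => -((OrderDual.ofDual n : ℕ) : ℤ)) fun x y hxy => ?_).trans f⟩
    exact neg_lt_neg (Nat.cast_lt.2 (OrderDual.ofDual_lt_ofDual.2 hxy))

theorem ArrowOmegaOmegaStar.not_coveredByWFs_univ (h : ArrowOmegaOmegaStar L) :
    ¬ CoveredByWFs (Set.univ : Set L) := by
  rintro ⟨A, B, hAB, hA, hB⟩
  rcases h B A (by rw [Set.union_comm]; exact Set.univ_subset_iff.1 hAB) with ⟨⟨f⟩⟩ | ⟨⟨f⟩⟩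
  · exact Set.isWF_iff_no_descending_seq.1 hB (fun n => OrderDual.toDual (f n).1)
      (fun _ _ hij => f.strictMono hij) fun n => (f n).2
  · exact Set.isWF_iff_no_descending_seq.1 hA (fun n => (f (OrderDual.toDual n)).1)
      (fun _ _ hij => f.strictMono (OrderDual.toDual_lt_toDual.2 hij)) fun n => (f _).2

end Embeddings

section Condensation

variable {L : Type*} [LinearOrder L]

theorem coveredByWFs_setOf_ge (hL : ¬ Nonempty (ℕ ×ₗ ℕᵒᵈ ↪o L)) (a : L) :
    CoveredByWFs {c | a ≤ c ∧ CoveredByWFs (Set.Icc a c)} := by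
  set S := {c | a ≤ c ∧ CoveredByWFs (Set.Icc a c)} with hS
  by_cases h : ∃ y ∈ S, (S ∩ Set.Ici y).IsWF
  · obtain ⟨y, hy, hwf⟩ := h
    refine (hy.2.union (CoveredByWFs.of_isWF hwf)).mono fun c hc => ?_
    rcases le_total c y with hcy | hcy
    · exact Or.inl ⟨hc.1, hcy⟩
    · exact Or.inr ⟨hc, hcy⟩
  · refine (hL ?_).elim
    have ha : a ∈ S :=
      ⟨le_rfl, CoveredByWFs.of_isWF (by rw [Set.Icc_self]; exact Set.isWF_singleton)⟩
    have hseq : ∀ y : S, ∃ f : ℕ → L, StrictAnti f ∧ ∀ n, f n ∈ S ∩ Set.Ici y.1 := by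
      intro y
      by_contra hy
      exact h ⟨y, y.2, Set.isWF_iff_no_descending_seq.2 fun f hf hmem => hy ⟨f, hf, hmem⟩⟩
    choose f hf hmem using hseq
    let y : ℕ → S := fun k => (fun y : S => (⟨f y 0, (hmem y 0).1⟩ : S))^[k] ⟨a, ha⟩
    have hy : ∀ k, (y (k + 1)).1 = f (y k) 0 := fun k =>
      congrArg Subtype.val (Function.iterate_succ_apply' _ k _)
    refine nonempty_prodLex_embedding (fun k => f (y k)) (fun k => hf _) fun k n m => ?_
    calc f (y k) n ≤ f (y k) 0 := (hf _).antitone (Nat.zero_le n)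
      _ = y (k + 1) := (hy k).symm
      _ ≤ f (y (k + 1)) (m + 1) := (hmem _ _).2
      _ < f (y (k + 1)) m := hf _ (Nat.lt_succ_self m)

theorem coveredByWFs_setOf_le (hL : ¬ Nonempty (ℕᵒᵈ ×ₗ ℕ ↪o L)) (a : L) :
    CoveredByWFs {c | c ≤ a ∧ CoveredByWFs (Set.Icc c a)} := by
  have h := (coveredByWFs_setOf_ge (mt nonempty_prodLex_embedding_of_dual hL)
    (OrderDual.toDual a)).dual
  refine h.mono fun c hc => ⟨hc.1, ?_⟩
  refine hc.2.dual.mono fun x hx => ⟨hx.2, hx.1⟩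

/-- The condensation identifying two points when the interval between them is covered by a
well-ordered set and a reversely well-ordered set. -/
def wfSetoid (L : Type*) [LinearOrder L] : Setoid L where
  r a b := CoveredByWFs (Set.uIcc a b)
  iseqv :=
    { refl := fun a => CoveredByWFs.of_isWF (by rw [Set.uIcc_self]; exact Set.isWF_singleton)
      symm := fun {a b} h => by rwa [Set.uIcc_comm]
      trans := fun h h' => (h.union h').mono Set.uIcc_subset_uIcc_union_uIcc }

theorem wfSetoid_iff {a b : L} : wfSetoid L a b ↔ CoveredByWFs (Set.uIcc a b) := Iff.rfl

theorem coveredByWFs_univ (h₁ : ¬ Nonempty (ℕᵒᵈ ×ₗ ℕ ↪o L))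
    (h₂ : ¬ Nonempty (ℕ ×ₗ ℕᵒᵈ ↪o L)) : CoveredByWFs (Set.univ : Set L) := by
  by_cases hR : ∀ a b : L, wfSetoid L a b
  · rcases isEmpty_or_nonempty L with hE | ⟨⟨a⟩⟩
    · exact CoveredByWFs.of_isWF (by rw [Set.eq_empty_of_isEmpty Set.univ]; exact Set.isWF_empty)
    · refine ((coveredByWFs_setOf_ge h₂ a).union (coveredByWFs_setOf_le h₁ a)).mono fun c _ => ?_
      rcases le_total a c with h | h
      · exact Or.inl ⟨h, (wfSetoid_iff.1 (hR a c)).mono Set.Icc_subset_uIcc⟩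
      · exact Or.inr ⟨h, (wfSetoid_iff.1 (hR c a)).mono Set.Icc_subset_uIcc⟩
  push Not at hR
  obtain ⟨a₀, b₀, hab₀⟩ := hR
  let rep : L → L := fun c => (Quotient.mk (wfSetoid L) c).out
  have hrep : ∀ c, wfSetoid L (rep c) c := fun c => Quotient.mk_out (s := wfSetoid L) c
  have hne : ∀ a b, rep a ≠ rep b → ¬ wfSetoid L (rep a) (rep b) := by
    intro a b hab h
    refine hab (congrArg Quotient.out (Quotient.sound (s := wfSetoid L) ?_))
    exact (wfSetoid L).trans ((wfSetoid L).symm (hrep a)) ((wfSetoid L).trans h (hrep b))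
  have hnt : Nontrivial (Set.range rep) := by
    refine ⟨⟨rep a₀, a₀, rfl⟩, ⟨rep b₀, b₀, rfl⟩, fun h => hab₀ ?_⟩
    have h' : rep a₀ = rep b₀ := congrArg Subtype.val h
    exact (wfSetoid L).trans ((wfSetoid L).symm (hrep a₀)) (h' ▸ hrep b₀)
  have hdense : DenselyOrdered (Set.range rep) := by
    refine ⟨?_⟩
    rintro ⟨_, a, rfl⟩ ⟨_, b, rfl⟩ hab
    replace hab : rep a < rep b := hab
    have hnab := hne a b hab.ne
    obtain ⟨c, hc₁, hc₂⟩ : ∃ c,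
        ¬ CoveredByWFs (Set.Icc (rep a) c) ∧ ¬ CoveredByWFs (Set.Icc c (rep b)) := by
      by_contra! hcon
      refine hnab (wfSetoid_iff.2 ?_)
      rw [Set.uIcc_of_le hab.le]
      refine ((coveredByWFs_setOf_ge h₂ (rep a)).union
        (coveredByWFs_setOf_le h₁ (rep b))).mono fun c hc => ?_
      by_cases hg : CoveredByWFs (Set.Icc (rep a) c)
      · exact Or.inl ⟨hc.1, hg⟩
      · exact Or.inr ⟨hc.2, hcon c hg⟩
    refine ⟨⟨rep c, c, rfl⟩, ?_, ?_⟩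
    · refine Subtype.mk_lt_mk.2 (lt_of_not_ge fun hle => hc₁ ?_)
      refine (wfSetoid_iff.1 (hrep c)).mono ?_
      exact (Set.Icc_subset_Icc_left hle).trans Set.Icc_subset_uIcc
    · refine Subtype.mk_lt_mk.2 (lt_of_not_ge fun hle => hc₂ ?_)
      refine (wfSetoid_iff.1 (hrep c)).mono ?_
      exact (Set.Icc_subset_Icc_right hle).trans Set.Icc_subset_uIcc'
  have : Countable (ℕ ×ₗ ℕᵒᵈ) := inferInstanceAs (Countable (ℕ × ℕ))
  obtain ⟨f⟩ := Order.embedding_from_countable_to_dense (ℕ ×ₗ ℕᵒᵈ) (Set.range rep)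
  exact (h₂ ⟨f.trans (OrderEmbedding.subtype _)⟩).elim

end Condensation

/-- The following are equivalent for a linear order `L`:
(1) `L → (ℤ, ℤ)¹`; (2) `L → (ω, ω*)¹`; (3) `L` contains a copy of `ω·ω*`
(the lexicographic order on `ℕᵒᵈ × ℕ`) or a copy of `ω*·ω` (the lexicographic
order on `ℕ × ℕᵒᵈ`). -/
theorem arrowZZ_tfae {L : Type*} [LinearOrder L] :
    (ArrowZZ L ↔ ArrowOmegaOmegaStar L) ∧
    (ArrowOmegaOmegaStar L ↔
      (Nonempty (ℕᵒᵈ ×ₗ ℕ ↪o L) ∨ Nonempty (ℕ ×ₗ ℕᵒᵈ ↪o L))) := by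
  have h₃₁ : (Nonempty (ℕᵒᵈ ×ₗ ℕ ↪o L) ∨ Nonempty (ℕ ×ₗ ℕᵒᵈ ↪o L)) → ArrowZZ L := by
    rintro (h | ⟨⟨f⟩⟩)
    · obtain ⟨f⟩ := nonempty_prodLex_dual_embedding h
      exact (ArrowZZ.of_embedding f).of_dual
    · exact ArrowZZ.of_embedding f
  have h₂₃ : ArrowOmegaOmegaStar L →
      (Nonempty (ℕᵒᵈ ×ₗ ℕ ↪o L) ∨ Nonempty (ℕ ×ₗ ℕᵒᵈ ↪o L)) := by
    intro h
    by_contra! hcon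
    exact h.not_coveredByWFs_univ
      (coveredByWFs_univ (not_nonempty_iff.2 hcon.1) (not_nonempty_iff.2 hcon.2))
  exact ⟨⟨ArrowZZ.arrowOmegaOmegaStar, fun h => h₃₁ (h₂₃ h)⟩,
    h₂₃, fun h => (h₃₁ h).arrowOmegaOmegaStar⟩
end

section
/- If a linear order L satisfies L → (ℤ, ℤ)¹, then for every n ≥ 2, L → (ℤ, …, ℤ)¹ with n entries: for every partition of L into n sets, at least one of the sets contains a copy of ℤ. -/
/-- An ascending sequence in `X` lying above a descending sequence in `X` yields a copy of `ℤ`. -/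
theorem nonempty_int_orderEmbedding {L : Type*} [LinearOrder L] {X : Set L} {f g : ℕ → L}
    (hf : ∀ n, f n < f (n + 1)) (hg : ∀ n, g (n + 1) < g n) (hgf : g 0 < f 0)
    (hfX : ∀ n, f n ∈ X) (hgX : ∀ n, g n ∈ X) : Nonempty (ℤ ↪o X) := by
  let e : ℤ → X
    | Int.ofNat n => ⟨f n, hfX n⟩
    | Int.negSucc n => ⟨g n, hgX n⟩
  refine ⟨OrderEmbedding.ofStrictMono e (strictMono_int_of_lt_succ ?_)⟩
  rintro (n | _ | n)
  · exact hf n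
  · exact hgf
  · exact hg n

/-- A set without a copy of `ℤ` is the union of a well-ordered set and a reversely well-ordered
set. -/
theorem exists_wellFoundedOn_union {L : Type*} [LinearOrder L] {X : Set L}
    (hX : ¬ Nonempty (ℤ ↪o X)) :
    ∃ W R : Set L, X = W ∪ R ∧ W.WellFoundedOn (· < ·) ∧ R.WellFoundedOn (· > ·) := by
  let W : Set L := {x ∈ X | (X ∩ Set.Iio x).WellFoundedOn (· < ·)}
  refine ⟨W, X \ W, (Set.union_sdiff_cancel (Set.sep_subset _ _)).symm, ?_, ?_⟩
  · rw [Set.wellFoundedOn_iff_no_descending_seq]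
    intro f hf
    have h0 := (hf 0).2
    rw [Set.wellFoundedOn_iff_no_descending_seq] at h0
    let s : ((· > ·) : ℕ → ℕ → Prop) ↪r ((· > ·) : ℕ → ℕ → Prop) :=
      ⟨⟨Nat.succ, Nat.succ_injective⟩, Nat.succ_lt_succ_iff⟩
    exact h0 (s.trans f) fun n => ⟨(hf _).1, f.map_rel_iff.2 (Nat.succ_pos n)⟩
  · rw [Set.wellFoundedOn_iff_no_descending_seq]
    intro f hf
    have h0 : ¬ (X ∩ Set.Iio (f 0)).WellFoundedOn (· < ·) := fun h => (hf 0).2 ⟨(hf 0).1, h⟩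
    rw [Set.wellFoundedOn_iff_no_descending_seq] at h0
    push Not at h0
    obtain ⟨g, hg⟩ := h0
    exact hX (nonempty_int_orderEmbedding (fun n => f.map_rel_iff.2 n.lt_succ_self)
      (fun n => g.map_rel_iff.2 n.lt_succ_self) (hg 0).2 (fun n => (hf n).1) fun n => (hg n).1)

theorem not_nonempty_int_orderEmbedding_of_wellFoundedOn_lt {L : Type*} [LinearOrder L]
    {W : Set L} (hW : W.WellFoundedOn (· < ·)) : ¬ Nonempty (ℤ ↪o W) := by
  rintro ⟨e⟩
  have : WellFounded ((· < ·) : ℤ → ℤ → Prop) :=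
    (RelEmbedding.wellFounded e.ltEmbedding hW :)
  obtain ⟨m, -, hm⟩ := this.has_min Set.univ ⟨0, trivial⟩
  exact hm (m - 1) trivial (sub_one_lt m)

theorem not_nonempty_int_orderEmbedding_of_wellFoundedOn_gt {L : Type*} [LinearOrder L]
    {R : Set L} (hR : R.WellFoundedOn (· > ·)) : ¬ Nonempty (ℤ ↪o R) := by
  rintro ⟨e⟩
  have : WellFounded ((· > ·) : ℤ → ℤ → Prop) :=
    (RelEmbedding.wellFounded e.ltEmbedding.swap hR :)
  obtain ⟨m, -, hm⟩ := this.has_min Set.univ ⟨0, trivial⟩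
  exact hm (m + 1) trivial (lt_add_one m)

/-- If `L → (ℤ, ℤ)¹` then, for every `n ≥ 2`, `L → (ℤ, …, ℤ)¹` with `n`
entries: for every partition of `L` into `n` sets, at least one of the sets
contains a copy of `ℤ`. -/
theorem arrowZZ_iterate {L : Type*} [LinearOrder L] (h : ArrowZZ L) :
    ∀ n : ℕ, 2 ≤ n → ∀ P : Fin n → Set L, (⋃ i, P i) = Set.univ →
      ∃ i : Fin n, Nonempty (ℤ ↪o (P i)) := by
  intro n _ P hP
  by_contra! hne
  choose W R hPWR hW hR using fun i =>
    exists_wellFoundedOn_union (not_nonempty_iff.2 (hne i))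
  have hcover : (⋃ i, W i) ∪ (⋃ i, R i) = Set.univ := by
    rw [← Set.iUnion_union_distrib, ← hP]
    exact Set.iUnion_congr fun i => (hPWR i).symm
  have hWU : (⋃ i, W i).WellFoundedOn (· < ·) := by
    simpa using (Finset.wellFoundedOn_bUnion Finset.univ (f := W)).2 fun i _ => hW i
  have hRU : (⋃ i, R i).WellFoundedOn (· > ·) := by
    simpa using (Finset.wellFoundedOn_bUnion Finset.univ (f := R)).2 fun i _ => hR i
  exact (h _ _ hcover).elim (not_nonempty_int_orderEmbedding_of_wellFoundedOn_lt hWU)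
    (not_nonempty_int_orderEmbedding_of_wellFoundedOn_gt hRU)
end

section
/- Main theorem: for every linear order L and every natural number n ≥ 3, the following are equivalent: (1) L contains a copy of ω·ω* (the lexicographic order on ℕᵒᵈ × ℕ) or a copy of ω*·ω (the lexicographic order on ℕ × ℕᵒᵈ); (2) L → (ℤ, n)², i.e., every 2-coloring of L contains a copy of ℤ all of whose pairs are red, or a set of n elements all of whose pairs are blue. -/
open Filter

/-- A copy of `ω·ω*` amounts to a descending sequence of strictly increasing sequences. -/
lemma nonempty_natOD_lex_nat_embedding_iff {L : Type*} [LinearOrder L] :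
    Nonempty (ℕᵒᵈ ×ₗ ℕ ↪o L) ↔
      ∃ f : ℕ → ℕ → L, (∀ i, StrictMono (f i)) ∧ ∀ i j, i < j → ∀ a b, f j a < f i b := by
  constructor
  · rintro ⟨e⟩
    refine ⟨fun i a => e (toLex (OrderDual.toDual i, a)), fun i a b hab => ?_,
      fun i j hij a b => ?_⟩
    · exact e.strictMono (Prod.Lex.toLex_lt_toLex.2 (Or.inr ⟨rfl, hab⟩))
    · exact e.strictMono (Prod.Lex.toLex_lt_toLex.2 (Or.inl (OrderDual.toDual_lt_toDual.2 hij)))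
  · rintro ⟨f, hf, hlt⟩
    refine ⟨OrderEmbedding.ofStrictMono
      (fun p => f (OrderDual.ofDual (ofLex p).1) (ofLex p).2) fun p q hpq => ?_⟩
    rcases Prod.Lex.lt_iff.1 hpq with h | ⟨h, h'⟩
    · exact hlt _ _ (OrderDual.ofDual_lt_ofDual.2 h) _ _
    · simpa only [h] using hf _ h'

/-- A copy of `ω*·ω` amounts to an ascending sequence of strictly decreasing sequences. -/
lemma nonempty_nat_lex_natOD_embedding_iff {L : Type*} [LinearOrder L] :
    Nonempty (ℕ ×ₗ ℕᵒᵈ ↪o L) ↔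
      ∃ f : ℕ → ℕ → L, (∀ i, StrictAnti (f i)) ∧ ∀ i j, i < j → ∀ a b, f i a < f j b := by
  constructor
  · rintro ⟨e⟩
    refine ⟨fun i a => e (toLex (i, OrderDual.toDual a)), fun i a b hab => ?_,
      fun i j hij a b => ?_⟩
    · exact e.strictMono (Prod.Lex.toLex_lt_toLex.2
        (Or.inr ⟨rfl, OrderDual.toDual_lt_toDual.2 hab⟩))
    · exact e.strictMono (Prod.Lex.toLex_lt_toLex.2 (Or.inl hij))
  · rintro ⟨f, hf, hlt⟩
    refine ⟨OrderEmbedding.ofStrictMono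
      (fun p => f (ofLex p).1 (OrderDual.ofDual (ofLex p).2)) fun p q hpq => ?_⟩
    rcases Prod.Lex.lt_iff.1 hpq with h | ⟨h, h'⟩
    · exact hlt _ _ h _ _
    · simpa only [h] using hf _ (OrderDual.ofDual_lt_ofDual.2 h')

/-- Diagonal construction: pick the terms of a sequence one after the other, the `k`-th one
generically for the filter `F k`. -/
lemma exists_seq_forall_lt_of_eventually {α : Type*} (F : ℕ → Filter α) [∀ k, NeBot (F k)]
    (R : ℕ → ℕ → α → α → Prop)
    (h : ∀ k, ∀ᶠ x in F k, ∀ m, k < m → ∀ᶠ y in F m, R k m x y) :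
    ∃ z : ℕ → α, ∀ k l, k < l → R k l (z k) (z l) := by
  let G : ℕ → Set α := fun k => {x | ∀ m, k < m → ∀ᶠ y in F m, R k m x y}
  have step : ∀ k (p : ∀ m, m < k → G m), ∃ x : G k, ∀ m (hm : m < k), R m k (p m hm) x := by
    intro k p
    have h1 : ∀ᶠ x in F k, ∀ m : Fin k, R m k (p m m.2) x :=
      eventually_all.2 fun m => (p m m.2).2 k m.2
    obtain ⟨x, hx, hx'⟩ := ((h k).and h1).exists
    exact ⟨⟨x, hx⟩, fun m hm => hx' ⟨m, hm⟩⟩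
  choose g hg using step
  let z : ∀ k, G k := fun k => Nat.lt_wfRel.wf.fix (C := fun k => G k) g k
  have hz : ∀ k, z k = g k fun m _ => z m := fun k => WellFounded.fix_eq _ _ _
  refine ⟨fun k => z k, fun k l hkl => ?_⟩
  have := hg l (fun m _ => z m) k hkl
  rwa [← hz l] at this

/-- An increasing sequence of length `n` with blue pairs gives a blue set of size `n`. -/
lemma exists_finset_of_seq {L : Type*} [LinearOrder L] {c : L → L → Bool} {n : ℕ} (z : ℕ → L)
    (hz : ∀ k l, k < l → l < n → z k < z l ∧ c (z k) (z l) = false) :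
    ∃ s : Finset L, s.card = n ∧ ∀ x ∈ s, ∀ y ∈ s, x < y → c x y = false := by
  refine ⟨(Finset.range n).image z, ?_, ?_⟩
  · rw [Finset.card_image_of_injOn, Finset.card_range]
    intro a ha b hb hab
    simp only [Finset.coe_range, Set.mem_Iio] at ha hb
    rcases lt_trichotomy a b with h | h | h
    · exact absurd hab (hz a b h hb).1.ne
    · exact h
    · exact absurd hab (hz b a h ha).1.ne'
  · simp only [Finset.mem_image, Finset.mem_range]
    rintro _ ⟨a, ha, rfl⟩ _ ⟨b, hb, rfl⟩ hab
    rcases lt_trichotomy a b with h | h | h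
    · exact (hz a b h hb).2
    · exact absurd hab (by simp [h])
    · exact absurd hab (hz b a h ha).1.le.not_gt

/-- `ω·ω* → (ℤ, n)²`. -/
lemma exists_red_int_or_blue_finset {L : Type*} [LinearOrder L] (f : ℕ → ℕ → L)
    (hf : ∀ i, StrictMono (f i)) (hlt : ∀ i j, i < j → ∀ a b, f j a < f i b) (n : ℕ)
    (c : L → L → Bool) :
    (∃ e : ℤ ↪o L, ∀ a b : ℤ, a < b → c (e a) (e b) = true) ∨
      (∃ s : Finset L, s.card = n ∧ ∀ x ∈ s, ∀ y ∈ s, x < y → c x y = false) := by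
  refine or_iff_not_imp_right.2 fun hblue => ?_
  let U : Ultrafilter ℕ := hyperfilter ℕ
  have hU : ∀ k : ℕ, ∀ᶠ m in (U : Filter ℕ), k < m := fun k =>
    Nat.hyperfilter_le_atTop (eventually_gt_atTop k)
  let W : ℕ → Filter L := fun i => map (f i) U
  let V : Filter L := (U : Filter ℕ).bind W
  have : ∀ i, NeBot (W i) := fun i => map_neBot
  have : NeBot V := by
    rw [← frequently_true_iff_neBot]
    intro h
    simp only [V, W, eventually_bind, eventually_map] at h
    exact U.neBot.ne (by simpa using h)
  have hV : ∀ p : L → Prop, (∀ᶠ x in V, p x) ↔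
      ∀ᶠ j in (U : Filter ℕ), ∀ᶠ x in W j, p x := fun p => eventually_bind
  have hWW : ∀ i, ∀ᶠ x in W i, ∀ᶠ y in W i, x < y := fun i => by
    simp only [W, eventually_map]
    exact .of_forall fun a => (hU a).mono fun b hb => hf i hb
  have hWV : ∀ i, ∀ᶠ x in W i, ∀ᶠ y in V, y < x := fun i => by
    simp only [hV, W, eventually_map]
    exact .of_forall fun a => (hU i).mono fun j hj => .of_forall fun b => hlt i j hj b a
  have hW : ∀ i (p : L → Prop), (¬ ∀ᶠ x in W i, p x) ↔ ∀ᶠ x in W i, ¬ p x := fun i p => by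
    simp only [W, eventually_map]
    exact Ultrafilter.eventually_not.symm
  have hVn : ∀ p : L → Prop, (¬ ∀ᶠ x in V, p x) ↔ ∀ᶠ x in V, ¬ p x := fun p => by
    simp only [hV, ← hW]
    exact Ultrafilter.eventually_not.symm
  have redWW : ∀ i, ∀ᶠ x in W i, ∀ᶠ y in W i, c x y = true := by
    intro i
    by_contra hcon
    simp only [hW, Bool.not_eq_true] at hcon
    obtain ⟨z, hz⟩ := exists_seq_forall_lt_of_eventually (fun _ => W i)
      (fun _ _ x y => x < y ∧ c x y = false)
      (fun k => ((hWW i).and hcon).mono fun x hx m _ => hx.1.and hx.2)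
    exact hblue (exists_finset_of_seq z fun k l hkl _ => hz k l hkl)
  have redVV : ∀ᶠ x in V, ∀ᶠ y in V, c y x = true := by
    by_contra hcon
    simp only [hVn, Bool.not_eq_true] at hcon
    obtain ⟨z, hz⟩ := exists_seq_forall_lt_of_eventually (fun _ => V)
      (fun _ _ x y => y < x ∧ c y x = false)
      (fun k => (((hV _).2 (.of_forall hWV)).and hcon).mono fun x hx m _ => hx.1.and hx.2)
    exact hblue (exists_finset_of_seq (fun k => z (n - 1 - k)) fun k l hkl hl =>
      hz _ _ (by omega))
  have redVW : ∀ᶠ i in (U : Filter ℕ), ∀ᶠ x in V, ∀ᶠ y in W i, c x y = true := by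
    by_contra hcon
    rw [← Ultrafilter.eventually_not] at hcon
    simp only [hVn, hW, Bool.not_eq_true] at hcon
    simp only [hV] at hcon
    obtain ⟨t, ht⟩ := exists_seq_forall_lt_of_eventually (fun _ => (U : Filter ℕ))
      (fun _ _ i j => i < j ∧ ∀ᶠ x in W j, ∀ᶠ y in W i, c x y = false)
      (fun k => hcon.mono fun i hi m _ => (hU i).and hi)
    obtain ⟨z, hz⟩ := exists_seq_forall_lt_of_eventually (fun k => W (t (n - 1 - k)))
      (fun k m x y => m < n → x < y ∧ c x y = false) (by
        intro k
        have key : ∀ m : Fin n, ∀ᶠ x in W (t (n - 1 - k)), k < m →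
            ∀ᶠ y in W (t (n - 1 - m)), x < y ∧ c x y = false := by
          intro m
          by_cases hkm : k < m
          · obtain ⟨h1, h2⟩ := ht (n - 1 - m) (n - 1 - k) (by omega)
            refine h2.mp ?_
            simp only [W, eventually_map]
            exact .of_forall fun a ha _ =>
              (Eventually.of_forall fun b => hlt _ _ h1 a b).and ha
          · exact .of_forall fun x h => absurd h hkm
        refine (eventually_all.2 key).mono fun x hx m hkm => ?_
        by_cases hm : m < n
        · exact (hx ⟨m, hm⟩ hkm).mono fun y hy _ => hy
        · exact .of_forall fun y h => absurd h hm)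
    exact hblue (exists_finset_of_seq z fun k l hkl hl => hz k l hkl hl)
  obtain ⟨i, redWV, redVW⟩ := (((hV _).1 redVV).and redVW).exists
  have hVW : ∀ᶠ x in V, ∀ᶠ y in W i, x < y := by
    simp only [hV, W, eventually_map]
    exact (hU i).mono fun j hj => .of_forall fun b => .of_forall fun a => hlt i j hj b a
  have : ∀ k : ℕ, NeBot (if k % 2 = 0 then W i else V) := fun k => by
    split_ifs <;> infer_instance
  obtain ⟨z, hz⟩ := exists_seq_forall_lt_of_eventually
    (fun k => if k % 2 = 0 then W i else V)
    (fun _ m x y => if m % 2 = 0 then x < y ∧ c x y = true else y < x ∧ c y x = true) (by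
      intro k
      have key : ∀ᶠ x in (if k % 2 = 0 then W i else V),
          (∀ᶠ y in W i, x < y ∧ c x y = true) ∧ ∀ᶠ y in V, y < x ∧ c y x = true := by
        split_ifs
        · filter_upwards [hWW i, redWW i, hWV i, redWV] with x h1 h2 h3 h4
          exact ⟨h1.and h2, h3.and h4⟩
        · filter_upwards [hVW, redVW, (hV _).2 (.of_forall hWV), redVV] with x h1 h2 h3 h4
          exact ⟨h1.and h2, h3.and h4⟩
      refine key.mono fun x hx m _ => ?_
      by_cases hm : m % 2 = 0
      · simpa only [hm, if_true] using hx.1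
      · simpa only [hm, if_false] using hx.2)
  let τ : ℤ → ℕ := fun a => if 0 ≤ a then (2 * a).toNat else (-2 * a - 1).toNat
  have hτ : ∀ a b : ℤ, a < b → z (τ a) < z (τ b) ∧ c (z (τ a)) (z (τ b)) = true := by
    intro a b hab
    have hcases : (τ a < τ b ∧ τ b % 2 = 0) ∨ (τ b < τ a ∧ ¬ τ a % 2 = 0) := by
      simp only [τ]
      split_ifs <;> omega
    rcases hcases with ⟨h1, h2⟩ | ⟨h1, h2⟩
    · simpa only [h2, if_true] using hz _ _ h1
    · simpa only [h2, if_false] using hz _ _ h1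
  exact ⟨OrderEmbedding.ofStrictMono (fun a => z (τ a)) fun a b hab => (hτ a b hab).1,
    fun a b hab => (hτ a b hab).2⟩

/-- If below every point of a nonempty set there is an increasing sequence in that set, then the
order contains a copy of `ω·ω*`. -/
lemma exists_descending_blocks {L : Type*} [LinearOrder L] {S : Set L} (hS : S.Nonempty)
    (h : ∀ z ∈ S, ∃ v : ℕ → L, StrictMono v ∧ ∀ k, v k ∈ S ∧ v k < z) :
    ∃ f : ℕ → ℕ → L, (∀ i, StrictMono (f i)) ∧ ∀ i j, i < j → ∀ a b, f j a < f i b := by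
  choose! v hv hvS using h
  obtain ⟨z₀, hz₀⟩ := hS
  let z : ℕ → L := fun i => (fun x => v x 0)^[i] z₀
  have hz1 : ∀ i, z (i + 1) = v (z i) 0 := fun i => Function.iterate_succ_apply' _ _ _
  have hz : ∀ i, z i ∈ S := by
    intro i
    induction i with
    | zero => exact hz₀
    | succ i ih =>
      rw [hz1]
      exact (hvS _ ih 0).1
  have hanti : StrictAnti z := strictAnti_nat_of_succ_lt fun i => by
    rw [hz1]
    exact (hvS _ (hz i) 0).2
  refine ⟨fun i => v (z i), fun i => hv _ (hz i), fun i j hij a b => ?_⟩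
  calc v (z j) a < z j := (hvS _ (hz j) a).2
    _ ≤ z (i + 1) := hanti.antitone hij
    _ = v (z i) 0 := hz1 i
    _ ≤ v (z i) b := (hv _ (hz i)).monotone (Nat.zero_le b)

/-- A set covered by a well-ordered set and a reversely well-ordered set. -/
def IsWFUnionCoWF {L : Type*} [LinearOrder L] (s : Set L) : Prop :=
  ∃ X Y : Set L, s ⊆ X ∪ Y ∧ X.WellFoundedOn (· < ·) ∧ Y.WellFoundedOn (· > ·)

lemma IsWFUnionCoWF.mono {L : Type*} [LinearOrder L] {s t : Set L} (ht : IsWFUnionCoWF t)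
    (hst : s ⊆ t) : IsWFUnionCoWF s :=
  let ⟨X, Y, h, hX, hY⟩ := ht
  ⟨X, Y, hst.trans h, hX, hY⟩

lemma IsWFUnionCoWF.union {L : Type*} [LinearOrder L] {s t : Set L} (hs : IsWFUnionCoWF s)
    (ht : IsWFUnionCoWF t) : IsWFUnionCoWF (s ∪ t) := by
  obtain ⟨X, Y, h, hX, hY⟩ := hs
  obtain ⟨X', Y', h', hX', hY'⟩ := ht
  refine ⟨X ∪ X', Y ∪ Y', ?_, hX.union hX', hY.union hY'⟩
  rw [Set.union_union_union_comm]
  exact Set.union_subset_union h h'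

lemma exists_strictMono_of_not_isWFUnionCoWF {L : Type*} [LinearOrder L] {s : Set L}
    (hs : ¬ IsWFUnionCoWF s) : ∃ v : ℕ → L, StrictMono v ∧ ∀ k, v k ∈ s := by
  have h : ¬ s.WellFoundedOn (· > ·) := fun h =>
    hs ⟨∅, s, by simp, Set.wellFoundedOn_empty _, h⟩
  rw [Set.wellFoundedOn_iff_no_descending_seq] at h
  push Not at h
  obtain ⟨v, hv⟩ := h
  exact ⟨v, fun a b hab => v.map_rel_iff.2 hab, fun k => hv k⟩

lemma exists_strictAnti_of_not_isWFUnionCoWF {L : Type*} [LinearOrder L] {s : Set L}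
    (hs : ¬ IsWFUnionCoWF s) : ∃ v : ℕ → L, StrictAnti v ∧ ∀ k, v k ∈ s := by
  have h : ¬ s.WellFoundedOn (· < ·) := fun h =>
    hs ⟨s, ∅, by simp, h, Set.wellFoundedOn_empty _⟩
  rw [Set.wellFoundedOn_iff_no_descending_seq] at h
  push Not at h
  obtain ⟨v, hv⟩ := h
  exact ⟨v, fun a b hab => v.map_rel_iff.2 hab, fun k => hv k⟩

/-- A linear order that is not the union of a well-ordered set and a reversely well-ordered set
contains a copy of `ω·ω*` or of `ω*·ω`. -/
lemma nonempty_embedding_of_not_isWFUnionCoWF {L : Type*} [LinearOrder L]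
    (hL : ¬ IsWFUnionCoWF (Set.univ : Set L)) :
    Nonempty (ℕᵒᵈ ×ₗ ℕ ↪o L) ∨ Nonempty (ℕ ×ₗ ℕᵒᵈ ↪o L) := by
  have hne : ∀ {s : Set L}, ¬ IsWFUnionCoWF s → s.Nonempty := fun hs =>
    let ⟨v, _, hv⟩ := exists_strictMono_of_not_isWFUnionCoWF hs
    ⟨v 0, hv 0⟩
  have hsing : ∀ z : L, IsWFUnionCoWF {z} := fun z =>
    ⟨{z}, ∅, by simp, (Set.finite_singleton z).wellFoundedOn, Set.wellFoundedOn_empty _⟩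
  let I : Set L := {z | IsWFUnionCoWF (Set.Iic z)}
  by_cases hI : IsWFUnionCoWF I
  · left
    rw [nonempty_natOD_lex_nat_embedding_iff]
    have hJ : ¬ IsWFUnionCoWF Iᶜ := fun h => hL ((hI.union h).mono (by simp))
    refine exists_descending_blocks (hne hJ) fun z hz => ?_
    have hbad : ¬ IsWFUnionCoWF (Iᶜ ∩ Set.Iio z) := fun h =>
      hz (((hI.union h).union (hsing z)).mono fun x (hx : x ≤ z) => by
        rcases hx.lt_or_eq with h1 | h1
        · by_cases h2 : x ∈ I
          · exact Or.inl (Or.inl h2)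
          · exact Or.inl (Or.inr ⟨h2, h1⟩)
        · exact Or.inr h1)
    obtain ⟨v, hv, hv'⟩ := exists_strictMono_of_not_isWFUnionCoWF hbad
    exact ⟨v, hv, hv'⟩
  · right
    rw [nonempty_nat_lex_natOD_embedding_iff]
    suffices h : ∃ f : ℕ → ℕ → Lᵒᵈ, (∀ i, StrictMono (f i)) ∧
        ∀ i j, i < j → ∀ a b, f j a < f i b by
      obtain ⟨f, hf, hlt⟩ := h
      exact ⟨fun i a => OrderDual.ofDual (f i a), fun i a b hab => hf i hab,
        fun i j hij a b => hlt i j hij b a⟩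
    refine exists_descending_blocks (S := OrderDual.ofDual ⁻¹' I) (hne hI) fun z hz => ?_
    have hbad : ¬ IsWFUnionCoWF (I ∩ Set.Ioi (OrderDual.ofDual z)) := fun h =>
      hI ((IsWFUnionCoWF.union hz h).mono fun x hx => by
        rcases le_or_gt x (OrderDual.ofDual z) with h1 | h1
        · exact Or.inl h1
        · exact Or.inr ⟨hx, h1⟩)
    obtain ⟨v, hv, hv'⟩ := exists_strictAnti_of_not_isWFUnionCoWF hbad
    exact ⟨fun k => OrderDual.toDual (v k), fun a b hab => hv hab, hv'⟩

/-- If `L` is the union of a well-ordered set and a reversely well-ordered set, colouring blue the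
pairs between the two parts yields neither a red copy of `ℤ` nor a blue triangle. -/
lemma IsWFUnionCoWF.exists_coloring {L : Type*} [LinearOrder L]
    (hL : IsWFUnionCoWF (Set.univ : Set L)) :
    ∃ c : L → L → Bool, (¬ ∃ e : ℤ ↪o L, ∀ a b : ℤ, a < b → c (e a) (e b) = true) ∧
      ∀ x y z, x < y → y < z → ¬ (c x y = false ∧ c y z = false ∧ c x z = false) := by
  classical
  obtain ⟨X, Y, hXY, hX, hY⟩ := hL
  refine ⟨fun x y => decide (x ∈ X ↔ y ∈ X), ?_, ?_⟩
  · rintro ⟨e, he⟩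
    simp only [decide_eq_true_eq] at he
    rw [Set.wellFoundedOn_iff_no_descending_seq] at hX hY
    by_cases h0 : e 0 ∈ X
    · refine hX ⟨⟨fun k : ℕ => e (-k), fun a b hab => by simpa using hab⟩, ?_⟩ fun k => ?_
      · intro a b
        change e (-a) < e (-b) ↔ b < a
        simp
      · change e (-k) ∈ X
        rcases Nat.eq_zero_or_pos k with rfl | hk
        · simpa using h0
        · exact (he (-k) 0 (by simpa using hk)).2 h0
    · refine hY ⟨⟨fun k : ℕ => e k, fun a b hab => by simpa using hab⟩, ?_⟩ fun k => ?_
      · intro a b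
        change e b < e a ↔ b < a
        simp
      · change e k ∈ Y
        refine (hXY (Set.mem_univ (e k))).resolve_left ?_
        rcases Nat.eq_zero_or_pos k with rfl | hk
        · simpa using h0
        · exact fun h => h0 ((he 0 k (by simpa using hk)).2 h)
  · intro x y z _ _
    simp only [decide_eq_false_iff_not]
    tauto


/-- **Main theorem.** For every linear order `L` and every `n ≥ 3`, the
following are equivalent: (1) `L` contains a copy of `ω·ω*` (the lexicographic
order on `ℕᵒᵈ × ℕ`) or a copy of `ω*·ω` (the lexicographic order on
`ℕ × ℕᵒᵈ`); (2) `L → (ℤ, n)²`: every 2-coloring of the pairs of `L`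
(red = `true`, blue = `false`) contains a copy of `ℤ` all of whose pairs are
red, or a set of `n` elements all of whose pairs are blue. -/
theorem ramsey_int (L : Type*) [LinearOrder L] (n : ℕ) (hn : 3 ≤ n) :
    (Nonempty (ℕᵒᵈ ×ₗ ℕ ↪o L) ∨ Nonempty (ℕ ×ₗ ℕᵒᵈ ↪o L)) ↔
    (∀ c : L → L → Bool,
      (∃ e : ℤ ↪o L, ∀ a b : ℤ, a < b → c (e a) (e b) = true) ∨
      (∃ s : Finset L, s.card = n ∧
        ∀ x ∈ s, ∀ y ∈ s, x < y → c x y = false)) := by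
  constructor
  · rintro (h | h) c
    · obtain ⟨f, hf, hlt⟩ := nonempty_natOD_lex_nat_embedding_iff.1 h
      exact exists_red_int_or_blue_finset f hf hlt n c
    · obtain ⟨f, hf, hlt⟩ := nonempty_nat_lex_natOD_embedding_iff.1 h
      rcases exists_red_int_or_blue_finset (L := Lᵒᵈ)
        (fun i a => OrderDual.toDual (f i a))
        (fun i a b hab => OrderDual.toDual_lt_toDual.2 (hf i hab))
        (fun i j hij a b => OrderDual.toDual_lt_toDual.2 (hlt i j hij b a)) n
        (fun x y => c (OrderDual.ofDual y) (OrderDual.ofDual x)) with ⟨e, he⟩ | ⟨s, hs, hs'⟩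
      · refine Or.inl ⟨OrderEmbedding.ofStrictMono (fun a => OrderDual.ofDual (e (-a)))
          fun a b hab => ?_, fun a b hab => he (-b) (-a) (by omega)⟩
        exact e.strictMono (neg_lt_neg hab)
      · exact Or.inr ⟨s, hs, fun x hx y hy hxy => hs' y hy x hx hxy⟩
  · intro h
    by_contra hcon
    have hL : IsWFUnionCoWF (Set.univ : Set L) := by
      by_contra hL
      exact hcon (nonempty_embedding_of_not_isWFUnionCoWF hL)
    obtain ⟨c, hred, hblue⟩ := hL.exists_coloring
    rcases h c with h | ⟨s, hs, hs'⟩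
    · exact hred h
    · let g := s.orderEmbOfFin hs
      have hg : ∀ i j, i < j → g i < g j ∧ c (g i) (g j) = false := fun i j hij =>
        ⟨g.strictMono hij, hs' _ (s.orderEmbOfFin_mem hs i) _ (s.orderEmbOfFin_mem hs j)
          (g.strictMono hij)⟩
      have h01 := hg ⟨0, by omega⟩ ⟨1, by omega⟩ (by simp)
      have h12 := hg ⟨1, by omega⟩ ⟨2, by omega⟩ (by simp)
      have h02 := hg ⟨0, by omega⟩ ⟨2, by omega⟩ (by simp)
      exact hblue _ _ _ h01.1 h12.1 ⟨h01.2, h12.2, h02.2⟩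
end

section
/- For every natural number n ≥ 2, ω*·ω → (ω*·ω, n)²: for every 2-coloring of the lexicographic order on ℕ × ℕᵒᵈ, either there is a subset order-isomorphic to ω*·ω all of whose pairs are red, or there is a set of n elements all of whose pairs are blue. -/
open Filter

theorem Ultrafilter.exists_eventually_eq {α β : Type*} [Finite β] (U : Ultrafilter α)
    (f : α → β) : ∃ k, ∀ᶠ x in (U : Filter α), f x = k := by
  obtain ⟨k, hk⟩ := Ultrafilter.eq_pure_of_finite (U.map f)
  have h : {k} ∈ U.map f := by simp [hk]
  exact ⟨k, h⟩

/-- Ramsey's theorem for increasing quadruples of natural numbers. -/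
theorem exists_strictMono_quadruple_eq {β : Type*} [Finite β] (F : ℕ → ℕ → ℕ → ℕ → β) :
    ∃ h : ℕ → ℕ, StrictMono h ∧ ∃ k, ∀ p q r s, p < q → q < r → r < s →
      F (h p) (h q) (h r) (h s) = k := by
  set U : Ultrafilter ℕ := hyperfilter ℕ
  choose L₃ hL₃ using fun a b c ↦ U.exists_eventually_eq (F a b c)
  choose L₂ hL₂ using fun a b ↦ U.exists_eventually_eq (L₃ a b)
  choose L₁ hL₁ using fun a ↦ U.exists_eventually_eq (L₂ a)
  obtain ⟨k, hk⟩ := U.exists_eventually_eq L₁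
  have hgt (m : ℕ) : ∀ᶠ y in (U : Filter ℕ), m < y :=
    (Nat.hyperfilter_le_atTop : (U : Filter ℕ) ≤ atTop) (eventually_gt_atTop m)
  let Good (S : Finset ℕ) : Prop := (∀ a ∈ S, L₁ a = k) ∧
    (∀ a ∈ S, ∀ b ∈ S, a < b → L₂ a b = L₁ a) ∧
    (∀ a ∈ S, ∀ b ∈ S, ∀ c ∈ S, a < b → b < c → L₃ a b c = L₂ a b) ∧
    ∀ a ∈ S, ∀ b ∈ S, ∀ c ∈ S, ∀ d ∈ S, a < b → b < c → c < d → F a b c d = L₃ a b c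
  have extend (S : {S // Good S}) : ∃ y, (∀ a ∈ S.1, a < y) ∧ Good (insert y S.1) := by
    obtain ⟨S, h₁, h₂, h₃, h₄⟩ := S
    have ev : ∀ᶠ y in (U : Filter ℕ), (∀ a ∈ S, a < y) ∧ L₁ y = k ∧
        (∀ a ∈ S, L₂ a y = L₁ a) ∧ (∀ a ∈ S, ∀ b ∈ S, L₃ a b y = L₂ a b) ∧
        ∀ a ∈ S, ∀ b ∈ S, ∀ c ∈ S, F a b c y = L₃ a b c := by
      simp only [eventually_and, eventually_all_finset]
      exact ⟨fun a _ ↦ hgt a, hk, fun a _ ↦ hL₁ a, fun a _ b _ ↦ hL₂ a b,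
        fun a _ b _ c _ ↦ hL₃ a b c⟩
    obtain ⟨y, hy, e₁, e₂, e₃, e₄⟩ := ev.exists
    refine ⟨y, hy, ?_, ?_, ?_, ?_⟩
    · grind
    · grind
    · intro a ha b hb c hc hab hbc
      have hbS : b ∈ S := by grind
      have haS : a ∈ S := by grind
      grind
    · intro a ha b hb c hc d hd hab hbc hcd
      have hcS : c ∈ S := by grind
      have hbS : b ∈ S := by grind
      have haS : a ∈ S := by grind
      grind
  choose y hy hgood using extend
  let T : ℕ → {S // Good S} := Nat.rec ⟨∅, by simp [Good]⟩ fun _ S ↦ ⟨insert (y S) S.1, hgood S⟩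
  have hT (m : ℕ) : (T (m + 1)).1 = insert (y (T m)) (T m).1 := rfl
  have hmono : Monotone fun m ↦ (T m).1 :=
    monotone_nat_of_le_succ fun m ↦ by rw [hT]; exact Finset.subset_insert _ _
  have hmem {i m : ℕ} (him : i < m) : y (T i) ∈ (T m).1 :=
    hmono (Nat.succ_le_of_lt him) (by simp [hT])
  have hlt : StrictMono fun m ↦ y (T m) := fun i j hij ↦ hy _ _ (hmem hij)
  refine ⟨fun m ↦ y (T m), hlt, k, fun p q r s hpq hqr hrs ↦ ?_⟩
  obtain ⟨h₁, h₂, h₃, h₄⟩ := (T (s + 1)).2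
  have mp := hmem (show p < s + 1 by omega)
  have mq := hmem (show q < s + 1 by omega)
  have mr := hmem (show r < s + 1 by omega)
  have ms := hmem (show s < s + 1 by omega)
  rw [h₄ _ mp _ mq _ mr _ ms (hlt hpq) (hlt hqr) (hlt hrs),
    h₃ _ mp _ mq _ mr (hlt hpq) (hlt hqr), h₂ _ mp _ mq (hlt hpq), h₁ _ mp]

/-- A family of `n` distinct, pairwise `false` points gives a `false`-homogeneous set
of size `n`. -/
theorem exists_finset_card_eq_of_pairwise {α : Type*} [LinearOrder α] (c : α → α → Bool)
    (n : ℕ) (g : ℕ → α) (hg : Function.Injective g)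
    (h : ∀ i j, i < j → j < n → c (min (g i) (g j)) (max (g i) (g j)) = false) :
    ∃ s : Finset α, s.card = n ∧ ∀ x ∈ s, ∀ y ∈ s, x < y → c x y = false := by
  refine ⟨(Finset.range n).map ⟨g, hg⟩, by simp, fun x hx y hy hxy ↦ ?_⟩
  simp only [Finset.mem_map, Finset.mem_range, Function.Embedding.coeFn_mk] at hx hy
  obtain ⟨i, hi, rfl⟩ := hx
  obtain ⟨j, hj, rfl⟩ := hy
  rcases lt_trichotomy i j with hij | rfl | hij
  · simpa [hxy.le] using h i j hij hj
  · exact absurd hxy (lt_irrefl _)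
  · simpa [hxy.le] using h j i hij hi


/-- For every `n ≥ 2`, `ω*·ω → (ω*·ω, n)²`: for every 2-coloring of the pairs
of the lexicographic order on `ℕ × ℕᵒᵈ` (red = `true`, blue = `false`), there
is a copy of `ω*·ω` (the range of an order embedding) all of whose pairs are
red, or a set of `n` elements all of whose pairs are blue. -/
theorem omegaStar_mul_omega_arrow (n : ℕ) (hn : 2 ≤ n) :
    ∀ c : ℕ ×ₗ ℕᵒᵈ → ℕ ×ₗ ℕᵒᵈ → Bool,
      (∃ e : ℕ ×ₗ ℕᵒᵈ ↪o ℕ ×ₗ ℕᵒᵈ,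
        ∀ a b : ℕ ×ₗ ℕᵒᵈ, a < b → c (e a) (e b) = true) ∨
      (∃ s : Finset (ℕ ×ₗ ℕᵒᵈ), s.card = n ∧
        ∀ x ∈ s, ∀ y ∈ s, x < y → c x y = false) := by
  intro c
  let pt (i j : ℕ) : ℕ ×ₗ ℕᵒᵈ := toLex (i, OrderDual.toDual j)
  let D (x y : ℕ ×ₗ ℕᵒᵈ) : Bool := c (min x y) (max x y)
  have D_comm (x y) : D x y = D y x := by simp only [D, min_comm, max_comm]
  obtain ⟨h, hh, ⟨k₁, k₂, k₃, k₄⟩, hk⟩ := exists_strictMono_quadruple_eq fun p q r s ↦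
    (D (pt p q) (pt r s), D (pt p r) (pt q s), D (pt p s) (pt q r), D (pt p q) (pt p r))
  simp only [Prod.mk.injEq] at hk
  let v (i j : ℕ) : ℕ ×ₗ ℕᵒᵈ := pt (h i) (h j)
  have v_inj {i j i' j' : ℕ} (hv : v i j = v i' j') : i = i' ∧ j = j' := by
    have := congrArg ofLex hv
    simp only [v, pt, ofLex_toLex, Prod.mk.injEq, OrderDual.toDual_inj, hh.injective.eq_iff] at this
    exact this
  have separated {p q r s : ℕ} (hpq : p < q) (hqr : q < r) (hrs : r < s) :
      D (v p q) (v r s) = k₁ := (hk p q r s hpq hqr hrs).1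
  have crossing {p q r s : ℕ} (hpq : p < q) (hqr : q < r) (hrs : r < s) :
      D (v p r) (v q s) = k₂ := (hk p q r s hpq hqr hrs).2.1
  have nested {p q r s : ℕ} (hpq : p < q) (hqr : q < r) (hrs : r < s) :
      D (v p s) (v q r) = k₃ := (hk p q r s hpq hqr hrs).2.2.1
  have column {p q r : ℕ} (hpq : p < q) (hqr : q < r) :
      D (v p q) (v p r) = k₄ := (hk p q r (r + 1) hpq hqr r.lt_succ_self).2.2.2
  have blue (f g : ℕ → ℕ) (hfg : ∀ i j, f i = f j → g i = g j → i = j)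
      (hD : ∀ i j, i < j → j < n → D (v (f i) (g i)) (v (f j) (g j)) = false) :=
    exists_finset_card_eq_of_pairwise c n (fun i ↦ v (f i) (g i))
      (fun i j hij ↦ hfg i j (v_inj hij).1 (v_inj hij).2) hD
  rcases k₁.eq_false_or_eq_true with rfl | rfl
  case inr =>
    exact .inr <| blue (fun i ↦ 2 * i) (fun i ↦ 2 * i + 1) (by grind)
      fun i j _ _ ↦ separated (by omega) (by omega) (by omega)
  rcases k₂.eq_false_or_eq_true with rfl | rfl
  case inr =>
    exact .inr <| blue (fun i ↦ i) (fun i ↦ n + i) (by grind)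
      fun i j _ _ ↦ crossing (by omega) (by omega) (by omega)
  rcases k₃.eq_false_or_eq_true with rfl | rfl
  case inr =>
    exact .inr <| blue (fun i ↦ i) (fun i ↦ 2 * n - i) (by grind)
      fun i j _ _ ↦ nested (by omega) (by omega) (by omega)
  rcases k₄.eq_false_or_eq_true with rfl | rfl
  case inr =>
    exact .inr <| blue (fun _ ↦ 0) (fun i ↦ i + 1) (by grind)
      fun i j _ _ ↦ column (by omega) (by omega)
  left
  let e (x : ℕ ×ₗ ℕᵒᵈ) : ℕ ×ₗ ℕᵒᵈ :=
    v (2 * (ofLex x).1) (2 * Nat.pair (ofLex x).1 (OrderDual.ofDual (ofLex x).2) + 1)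
  have lt_cases {x y : ℕ ×ₗ ℕᵒᵈ} (hxy : x < y) : (ofLex x).1 < (ofLex y).1 ∨
      (ofLex x).1 = (ofLex y).1 ∧
        OrderDual.ofDual (ofLex y).2 < OrderDual.ofDual (ofLex x).2 :=
    Prod.Lex.lt_iff.1 hxy
  have he : StrictMono e := fun x y hxy ↦ by
    refine Prod.Lex.lt_iff.2 ?_
    rcases lt_cases hxy with h₁ | ⟨h₁, h₂⟩
    · exact .inl (hh (by omega))
    · refine .inr ⟨by simp [e, v, pt, h₁], OrderDual.toDual_lt_toDual.2 (hh ?_)⟩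
      have := Nat.pair_lt_pair_right (ofLex y).1 h₂
      rw [h₁]
      omega
  refine ⟨OrderEmbedding.ofStrictMono e he, fun x y hxy ↦ ?_⟩
  suffices H : D (e x) (e y) = true by simpa [D, (he hxy).le] using H
  have lx := Nat.left_le_pair (ofLex x).1 (OrderDual.ofDual (ofLex x).2)
  have ly := Nat.left_le_pair (ofLex y).1 (OrderDual.ofDual (ofLex y).2)
  rcases lt_cases hxy with h₁ | ⟨h₁, h₂⟩
  · have hne : Nat.pair (ofLex x).1 (OrderDual.ofDual (ofLex x).2) ≠
        Nat.pair (ofLex y).1 (OrderDual.ofDual (ofLex y).2) := fun H ↦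
      h₁.ne (Nat.pair_eq_pair.1 H).1
    rcases lt_or_gt_of_ne hne with h₂ | h₂
    · by_cases h₃ : Nat.pair (ofLex x).1 (OrderDual.ofDual (ofLex x).2) < (ofLex y).1
      · exact separated (by omega) (by omega) (by omega)
      · exact crossing (by omega) (by omega) (by omega)
    · exact nested (by omega) (by omega) (by omega)
  · have := Nat.pair_lt_pair_right (ofLex y).1 h₂
    rw [D_comm]
    simp only [e, h₁] at lx ⊢
    exact column (by omega) (by omega)
end

section
/- ω·2 + 1 → (ω+1, 3)²: for every 2-coloring of the linear order consisting of two consecutive copies of ℕ followed by a single top point (the order type ω + ω + 1), either there is a copy of ω+1 (an infinite increasing sequence together with an element above all of them) all of whose pairs are red, or there are three elements whose three pairs are all blue. -/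
open Filter

/-- A strictly increasing sequence below a point, with all pairs red, is a red copy of `ω + 1`. -/
theorem exists_red_withTop_nat_of_strictMono {L : Type*} [LinearOrder L] {c : L → L → Bool}
    {f : ℕ → L} {t : L} (hf : StrictMono f) (hft : ∀ n, f n < t)
    (hred : ∀ m n, m < n → c (f m) (f n) = true) (hredt : ∀ n, c (f n) t = true) :
    ∃ e : WithTop ℕ ↪o L, ∀ a b : WithTop ℕ, a < b → c (e a) (e b) = true := by
  let e : WithTop ℕ → L := fun a => WithTop.recTopCoe t f a
  have he : StrictMono e := by
    intro a b hab
    induction a with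
    | top => exact absurd hab not_top_lt
    | coe m =>
      induction b with
      | top => exact hft m
      | coe n => exact hf (WithTop.coe_lt_coe.mp hab)
  refine ⟨OrderEmbedding.ofStrictMono e he, fun a b hab => ?_⟩
  induction a with
  | top => exact absurd hab not_top_lt
  | coe m =>
    induction b with
    | top => exact hredt m
    | coe n => exact hred m n (WithTop.coe_lt_coe.mp hab)

/-- A 2-coloring of the pairs of `ℕ` without blue triangles has an infinite red set. -/
theorem exists_strictMono_red_of_no_blue_triangle {c : ℕ → ℕ → Bool}
    (h : ∀ x y z, x < y → y < z → c x y = false → c x z = false → c y z = true) :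
    ∃ g : ℕ → ℕ, StrictMono g ∧ ∀ m n, m < n → c (g m) (g n) = true := by
  by_cases hblue : ∃ x, ∃ᶠ n in atTop, c x n = false
  · obtain ⟨x, hx⟩ := hblue
    obtain ⟨φ, hφ, hφx⟩ :=
      extraction_of_frequently_atTop (hx.and_eventually (eventually_gt_atTop x))
    exact ⟨φ, hφ, fun m n hmn =>
      h x _ _ (hφx m).2 (hφ hmn) (hφx m).1 (hφx n).1⟩
  · have hev : ∀ x, ∀ᶠ n in atTop, x < n ∧ c x n = true := by
      intro x
      have hx := not_frequently.mp (not_exists.mp hblue x)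
      filter_upwards [hx, eventually_gt_atTop x] with n hn hxn
      exact ⟨hxn, by simpa using hn⟩
    obtain ⟨g, hg⟩ := exists_seq_of_forall_finset_exists (fun _ : ℕ => True)
      (fun x n => x < n ∧ c x n = true) fun s _ => by
        obtain ⟨n, hn⟩ := ((eventually_all_finset s).mpr fun x _ => hev x).exists
        exact ⟨n, trivial, hn⟩
    exact ⟨g, fun m n hmn => (hg.2 m n hmn).1, fun m n hmn => (hg.2 m n hmn).2⟩

/-- If there are no blue triangles and infinitely many terms of an increasing sequence are joined
in red to a point above it, there is a red copy of `ω + 1`. -/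
theorem exists_red_withTop_nat_of_frequently {L : Type*} [LinearOrder L] {c : L → L → Bool}
    (h : ∀ x y z, x < y → y < z → c x y = false → c x z = false → c y z = true)
    {f : ℕ → L} {t : L} (hf : StrictMono f) (hft : ∀ n, f n < t)
    (hred : ∃ᶠ n in atTop, c (f n) t = true) :
    ∃ e : WithTop ℕ ↪o L, ∀ a b : WithTop ℕ, a < b → c (e a) (e b) = true := by
  obtain ⟨φ, hφ, hφt⟩ := extraction_of_frequently_atTop hred
  obtain ⟨g, hg, hgred⟩ := exists_strictMono_red_of_no_blue_triangle
    (c := fun m n => c (f (φ m)) (f (φ n)))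
    fun x y z hxy hyz => h _ _ _ (hf (hφ hxy)) (hf (hφ hyz))
  exact exists_red_withTop_nat_of_strictMono (hf.comp (hφ.comp hg)) (fun n => hft _) hgred
    fun n => hφt _

/-- `ω·2 + 1 → (ω+1, 3)²`. The order `ω·2+1` is modelled as
`WithTop (ℕ ⊕ₗ ℕ)` (two consecutive copies of `ℕ` followed by a top point) and
`ω+1` as `WithTop ℕ` (`ℕ` with one additional top point). For every 2-coloring
of the pairs (red = `true`, blue = `false`), there is a copy of `ω+1` all of
whose pairs are red, or three elements whose three pairs are all blue. -/
theorem omega_two_add_one_arrow :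
    ∀ c : WithTop (ℕ ⊕ₗ ℕ) → WithTop (ℕ ⊕ₗ ℕ) → Bool,
      (∃ e : WithTop ℕ ↪o WithTop (ℕ ⊕ₗ ℕ),
        ∀ a b : WithTop ℕ, a < b → c (e a) (e b) = true) ∨
      (∃ s : Finset (WithTop (ℕ ⊕ₗ ℕ)), s.card = 3 ∧
        ∀ x ∈ s, ∀ y ∈ s, x < y → c x y = false) := by
  intro c
  by_cases htri : ∃ x y z, x < y ∧ y < z ∧ c x y = false ∧ c x z = false ∧ c y z = false
  · right
    obtain ⟨x, y, z, hxy, hyz, cxy, cxz, cyz⟩ := htri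
    have hxz := hxy.trans hyz
    refine ⟨{x, y, z}, Finset.card_eq_three.mpr ⟨x, y, z, hxy.ne, hxz.ne, hyz.ne, rfl⟩, ?_⟩
    intro a ha b hb hab
    simp only [Finset.mem_insert, Finset.mem_singleton] at ha hb
    rcases ha with rfl | rfl | rfl <;> rcases hb with rfl | rfl | rfl <;>
      first
      | assumption
      | exact absurd hab (lt_irrefl _)
      | exact absurd hab (by apply lt_asymm; assumption)
  · left
    have h : ∀ x y z, x < y → y < z → c x y = false → c x z = false → c y z = true := by
      intro x y z hxy hyz cxy cxz
      by_contra cyz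
      exact htri ⟨x, y, z, hxy, hyz, cxy, cxz, by simpa using cyz⟩
    let f : ℕ → WithTop (ℕ ⊕ₗ ℕ) := fun n => (Sum.inlₗ n : ℕ ⊕ₗ ℕ)
    let g : ℕ → WithTop (ℕ ⊕ₗ ℕ) := fun n => (Sum.inrₗ n : ℕ ⊕ₗ ℕ)
    have hf : StrictMono f := WithTop.coe_strictMono.comp Sum.Lex.inl_strictMono
    have hg : StrictMono g := WithTop.coe_strictMono.comp Sum.Lex.inr_strictMono
    have hft : ∀ n, f n < ⊤ := fun n => WithTop.coe_lt_top _
    have hgt : ∀ n, g n < ⊤ := fun n => WithTop.coe_lt_top _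
    have hfg : ∀ m n, f m < g n := fun m n =>
      WithTop.coe_lt_coe.mpr (Sum.Lex.inl_lt_inr m n)
    by_cases hfred : ∃ᶠ n in atTop, c (f n) ⊤ = true
    · exact exists_red_withTop_nat_of_frequently h hf hft hfred
    by_cases hgred : ∃ᶠ n in atTop, c (g n) ⊤ = true
    · exact exists_red_withTop_nat_of_frequently h hg hgt hgred
    obtain ⟨N, hN⟩ := eventually_atTop.mp (not_frequently.mp hfred)
    obtain ⟨k, hk⟩ := (not_frequently.mp hgred).exists
    have red_of_blue_top : ∀ x y, x < y → y < ⊤ → ¬ c x ⊤ = true → ¬ c y ⊤ = true →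
        c x y = true := by
      intro x y hxy hy hx hy'
      by_contra hc
      exact hy' (h x y ⊤ hxy hy (by simpa using hc) (by simpa using hx))
    have hmono : StrictMono fun n => f (N + n) := hf.comp fun _ _ hmn => by simpa using hmn
    exact exists_red_withTop_nat_of_strictMono hmono (fun n => hfg _ k)
      (fun m n hmn => red_of_blue_top _ _ (hmono hmn) (hft _) (hN _ (by simp)) (hN _ (by simp)))
      fun n => red_of_blue_top _ _ (hfg _ _) (hgt _) (hN _ (by simp)) hk
end

section
/- Erdős–Rado: ℚ → (ℚ, ℵ₀)². For every 2-coloring of the linear order ℚ of the rationals, either there is a subset of ℚ order-isomorphic to ℚ all of whose pairs are red, or there is an infinite subset all of whose pairs are blue. -/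
/-- If every finite family of labelled points that is pairwise `r`-related can be extended by a
point with any prescribed label, then there is a pairwise `r`-related choice of points for
countably many labels. -/
theorem exists_fun_rel_of_finset_extension {ι β : Type*} [Countable ι] (r : ι × β → ι × β → Prop)
    (h : ∀ s : Finset (ι × β), (s : Set (ι × β)).Pairwise r →
      ∀ i, ∃ y, ∀ p ∈ s, r p (i, y) ∧ r (i, y) p) :
    ∃ f : ι → β, ∀ i j, i ≠ j → r (i, f i) (j, f j) := by
  classical
  cases nonempty_encodable ι
  let P := {s : Finset (ι × β) // (s : Set (ι × β)).Pairwise r}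
  let D : ι → Order.Cofinal P := fun i ↦
    { carrier := {s | ∃ y, (i, y) ∈ s.1}
      isCofinal := by
        rintro ⟨s, hs⟩
        obtain ⟨y, hy⟩ := h s hs i
        refine ⟨⟨insert (i, y) s, ?_⟩, ⟨y, Finset.mem_insert_self _ _⟩,
          Finset.subset_insert _ _⟩
        rw [Finset.coe_insert]
        exact hs.insert fun p hp _ ↦ (hy p hp).symm }
  let p₀ : P := ⟨∅, by simp⟩
  let I := Order.idealOfCofinals p₀ D
  have hI : ∀ i, ∃ y, ∃ s ∈ I, (i, y) ∈ s.1 := fun i ↦ by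
    obtain ⟨s, ⟨y, hy⟩, hs⟩ := Order.cofinal_meets_idealOfCofinals p₀ D i
    exact ⟨y, s, hs, hy⟩
  choose f s hs hf using hI
  refine ⟨f, fun i j hij ↦ ?_⟩
  obtain ⟨t, -, hit, hjt⟩ := I.directed _ (hs i) _ (hs j)
  exact t.2 (hit (hf i)) (hjt (hf j)) fun e ↦ hij (congrArg Prod.fst e)

theorem isNowhereDense_union {X : Type*} [TopologicalSpace X] {s t : Set X}
    (hs : IsNowhereDense s) (ht : IsNowhereDense t) : IsNowhereDense (s ∪ t) := by
  unfold IsNowhereDense at *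
  rw [closure_union, interior_union_isClosed_of_interior_empty isClosed_closure ht, hs]

theorem isNowhereDense_biUnion_finset {X ι : Type*} [TopologicalSpace X] (s : Finset ι)
    {t : ι → Set X} (ht : ∀ i ∈ s, IsNowhereDense (t i)) : IsNowhereDense (⋃ i ∈ s, t i) := by
  classical
  induction s using Finset.induction_on with
  | empty => simp [isNowhereDense_empty]
  | insert a s _ ih =>
    rw [Finset.set_biUnion_insert]
    exact isNowhereDense_union (ht a (Finset.mem_insert_self a s))
      (ih fun i hi ↦ ht i (Finset.mem_insert_of_mem hi))

/-- The trace of a set on a nonempty open set contained in its closure is somewhere dense. -/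
theorem not_isNowhereDense_inter_of_subset_closure {X : Type*} [TopologicalSpace X] {s V : Set X}
    (hV : IsOpen V) (hne : V.Nonempty) (hVs : V ⊆ closure s) : ¬ IsNowhereDense (V ∩ s) := by
  intro h
  have hsub : V ⊆ interior (closure (V ∩ s)) :=
    interior_maximal (fun x hx ↦ hV.inter_closure ⟨hx, hVs hx⟩) hV
  rw [h] at hsub
  exact hne.ne_empty (Set.subset_empty_iff.1 hsub)

/-- If every somewhere dense set `X` has a point whose `B`-neighbourhood is somewhere dense in `X`,
then there is an infinite set of pairwise `B`-related points. -/
theorem exists_infinite_pairwise_of_not_isNowhereDense {α : Type*} [TopologicalSpace α]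
    {B : α → α → Prop} (hirr : ∀ x, ¬ B x x) (hsymm : ∀ x y, B x y → B y x)
    (huniv : ¬ IsNowhereDense (Set.univ : Set α))
    (h : ∀ X : Set α, ¬ IsNowhereDense X → ∃ x ∈ X, ¬ IsNowhereDense (X ∩ {y | B x y})) :
    ∃ H : Set α, H.Infinite ∧ H.Pairwise B := by
  choose g hgX hg using h
  let Y : ℕ → {X : Set α // ¬ IsNowhereDense X} := fun n ↦
    n.rec ⟨Set.univ, huniv⟩ fun _ X ↦ ⟨X.1 ∩ {y | B (g X.1 X.2) y}, hg X.1 X.2⟩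
  let x : ℕ → α := fun n ↦ g (Y n).1 (Y n).2
  have hanti : Antitone fun n ↦ (Y n).1 :=
    antitone_nat_of_succ_le fun n ↦ (Set.inter_subset_left : (Y n).1 ∩ {y | B (x n) y} ⊆ _)
  have hlt : ∀ m n, m < n → B (x m) (x n) := fun m n hmn ↦ by
    have hmem : x n ∈ (Y (m + 1)).1 := hanti (Nat.succ_le_of_lt hmn) (hgX _ _)
    exact hmem.2
  have hB : ∀ m n, m ≠ n → B (x m) (x n) := fun m n hmn ↦
    hmn.lt_or_gt.elim (hlt m n) fun hnm ↦ hsymm _ _ (hlt n m hnm)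
  have hinj : Function.Injective x := fun m n hmn ↦ by
    by_contra hne
    exact hirr (x n) (hmn ▸ hB m n hne)
  refine ⟨Set.range x, Set.infinite_range_of_injective hinj, ?_⟩
  rintro _ ⟨m, rfl⟩ _ ⟨n, rfl⟩ hne
  exact hB m n fun e ↦ hne (congrArg x e)

/-- If `X ⊆ ℚ` is somewhere dense but each of its points has a nowhere dense `B`-neighbourhood
in `X`, then `X` contains a copy of `ℚ` without `B`-related pairs. -/
theorem exists_orderEmbedding_forall_not_of_isNowhereDense {B : ℚ → ℚ → Prop}
    (hsymm : ∀ x y, B x y → B y x) {X : Set ℚ} (hX : ¬ IsNowhereDense X)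
    (h : ∀ x ∈ X, IsNowhereDense (X ∩ {y | B x y})) :
    ∃ e : ℚ ↪o ℚ, ∀ a b : ℚ, a < b → ¬ B (e a) (e b) := by
  classical
  obtain ⟨p, q, hpq, hsub⟩ :=
    isOpen_interior.exists_Ioo_subset (Set.nonempty_iff_ne_empty.2 hX)
  let S : Set ℚ := X ∩ Set.Ioo p q
  let r : ℚ × S → ℚ × S → Prop := fun u v ↦ u.1 < v.1 → u.2.1 < v.2.1 ∧ ¬ B u.2 v.2
  obtain ⟨f, hf⟩ := exists_fun_rel_of_finset_extension r (by
    intro s hs a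
    let lo : Finset ℚ := insert p ((s.filter (·.1 < a)).image (·.2.1))
    let hi : Finset ℚ := insert q ((s.filter (a < ·.1)).image (·.2.1))
    have hlohi : ∀ x ∈ lo, ∀ y ∈ hi, x < y := by
      simp only [lo, hi, Finset.mem_insert, Finset.mem_image, Finset.mem_filter]
      rintro x (rfl | ⟨u, ⟨hu, hua⟩, rfl⟩) y (rfl | ⟨v, ⟨hv, hav⟩, rfl⟩)
      · exact hpq
      · exact v.2.2.2.1
      · exact u.2.2.2.2
      · have huv := hua.trans hav
        exact (hs hu hv (fun e ↦ huv.ne (congrArg Prod.fst e)) huv).1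
    let V : Set ℚ := (⋂ x ∈ lo, Set.Ioi x) ∩ ⋂ y ∈ hi, Set.Iio y
    have hVo : IsOpen V := (isOpen_biInter_finset fun _ _ ↦ isOpen_Ioi).inter
      (isOpen_biInter_finset fun _ _ ↦ isOpen_Iio)
    have hVmem : ∀ m, m ∈ V ↔ (∀ x ∈ lo, x < m) ∧ ∀ y ∈ hi, m < y := fun m ↦ by simp [V]
    have hVne : V.Nonempty := by
      obtain ⟨m, hm⟩ := Order.exists_between_finsets lo hi hlohi
      exact ⟨m, (hVmem m).2 hm⟩
    have hVpq : V ⊆ Set.Ioo p q := fun m hm ↦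
      ⟨((hVmem m).1 hm).1 p (Finset.mem_insert_self _ _),
        ((hVmem m).1 hm).2 q (Finset.mem_insert_self _ _)⟩
    have hdense : ¬ IsNowhereDense (V ∩ X) := not_isNowhereDense_inter_of_subset_closure hVo hVne
      fun m hm ↦ interior_subset (hsub (hVpq hm))
    obtain ⟨y, ⟨hyV, hyX⟩, hy⟩ : ∃ y ∈ V ∩ X, y ∉ ⋃ u ∈ s, X ∩ {y | B u.2.1 y} :=
      Set.not_subset.1 fun hle ↦ hdense
        ((isNowhereDense_biUnion_finset s fun u _ ↦ h _ u.2.2.1).mono hle)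
    have hyB : ∀ u ∈ s, ¬ B u.2.1 y := fun u hu hB ↦
      hy (Set.mem_iUnion₂.2 ⟨u, hu, hyX, hB⟩)
    refine ⟨⟨y, hyX, hVpq hyV⟩, fun u hu ↦ ⟨fun hua ↦ ⟨?_, hyB u hu⟩, fun hau ↦
      ⟨?_, fun hB ↦ hyB u hu (hsymm _ _ hB)⟩⟩⟩
    · exact ((hVmem y).1 hyV).1 _ (Finset.mem_insert_of_mem
        (Finset.mem_image_of_mem _ (Finset.mem_filter.2 ⟨hu, hua⟩)))
    · exact ((hVmem y).1 hyV).2 _ (Finset.mem_insert_of_mem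
        (Finset.mem_image_of_mem _ (Finset.mem_filter.2 ⟨hu, hau⟩))))
  exact ⟨OrderEmbedding.ofStrictMono (fun a ↦ (f a).1) fun a b hab ↦ (hf a b hab.ne hab).1,
    fun a b hab ↦ (hf a b hab.ne hab).2⟩

/-- **Erdős–Rado:** `ℚ → (ℚ, ℵ₀)²`. For every 2-coloring of the pairs of the
rationals (red = `true`, blue = `false`), there is a subset of `ℚ`
order-isomorphic to `ℚ` (the range of an order embedding) all of whose pairs
are red, or an infinite subset all of whose pairs are blue. -/
theorem rat_arrow_rat_aleph0 :
    ∀ c : ℚ → ℚ → Bool,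
      (∃ e : ℚ ↪o ℚ, ∀ a b : ℚ, a < b → c (e a) (e b) = true) ∨
      (∃ H : Set ℚ, H.Infinite ∧ ∀ x ∈ H, ∀ y ∈ H, x < y → c x y = false) := by
  intro c
  let B : ℚ → ℚ → Prop := fun x y ↦ (x < y ∧ c x y = false) ∨ (y < x ∧ c y x = false)
  have hsymm : ∀ x y, B x y → B y x := fun _ _ ↦ Or.symm
  by_cases h : ∀ X : Set ℚ, ¬ IsNowhereDense X → ∃ x ∈ X, ¬ IsNowhereDense (X ∩ {y | B x y})
  · right
    obtain ⟨H, hH, hB⟩ := exists_infinite_pairwise_of_not_isNowhereDense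
      (fun x ↦ by simp [B]) hsymm (by simp [IsNowhereDense]) h
    refine ⟨H, hH, fun x hx y hy hxy ↦ ?_⟩
    rcases hB hx hy hxy.ne with hc | hc
    · exact hc.2
    · exact absurd hc.1 hxy.asymm
  · left
    push Not at h
    obtain ⟨X, hX, h⟩ := h
    obtain ⟨e, he⟩ := exists_orderEmbedding_forall_not_of_isNowhereDense hsymm hX h
    refine ⟨e, fun a b hab ↦ ?_⟩
    by_contra hc
    exact he a b hab (Or.inl ⟨e.strictMono hab, Bool.eq_false_of_not_eq_true hc⟩)
end

section
/- Erdős–Hajnal: let L be a countable linear order such that L → (ℤ, ℵ₀)², i.e., every 2-coloring of L contains a copy of ℤ all of whose pairs are red or an infinite set all of whose pairs are blue. Then L is not scattered: L contains a suborder isomorphic to ℚ. -/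
/-- A set `S` in a linear order is *`ℤ`-avoidable* if its pairs can be 2-colored (`r x y` meaning
that the pair `x < y` is red) with neither a red copy of `ℤ` nor an infinite blue set. -/
def IntAvoidable {L : Type*} [LinearOrder L] (S : Set L) : Prop :=
  ∃ r : L → L → Prop,
    (∀ e : ℤ ↪o L, (∀ a, e a ∈ S) → ∃ a b, a < b ∧ ¬ r (e a) (e b)) ∧
    ∀ H ⊆ S, H.Infinite → ∃ x ∈ H, ∃ y ∈ H, x < y ∧ r x y

namespace IntAvoidable

variable {L : Type*} [LinearOrder L] {S T : Set L}

theorem mono (hT : IntAvoidable T) (h : S ⊆ T) : IntAvoidable S := by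
  obtain ⟨r, h1, h2⟩ := hT
  exact ⟨r, fun e he => h1 e fun a => h (he a), fun H hH => h2 H (hH.trans h)⟩

theorem of_finite (hS : S.Finite) : IntAvoidable S :=
  ⟨fun _ _ => False, fun _ _ => ⟨0, 1, one_pos, id⟩, fun _ hH hinf => (hinf (hS.subset hH)).elim⟩

theorem union (hS : IntAvoidable S) (hT : IntAvoidable T) : IntAvoidable (S ∪ T) := by
  obtain ⟨r, hr1, hr2⟩ := hS
  obtain ⟨t, ht1, ht2⟩ := hT
  refine ⟨fun x y => (x ∈ S ∧ y ∈ S ∧ r x y) ∨ (x ∉ S ∧ y ∉ S ∧ t x y), ?_, ?_⟩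
  · intro e he
    by_contra! hred
    have hconst : ∀ a, e a ∈ S ↔ e 0 ∈ S := by
      intro a
      rcases lt_trichotomy a 0 with ha | rfl | ha
      · have := hred a 0 ha
        tauto
      · rfl
      · have := hred 0 a ha
        tauto
    by_cases h0 : e 0 ∈ S
    · obtain ⟨a, b, hab, hn⟩ := hr1 e fun a => (hconst a).2 h0
      have := hred a b hab
      have := (hconst a).2 h0
      tauto
    · obtain ⟨a, b, hab, hn⟩ := ht1 e fun a => (he a).resolve_left (mt (hconst a).1 h0)
      have := hred a b hab
      have := mt (hconst a).1 h0
      tauto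
  · intro H hH hinf
    rw [← Set.inter_union_sdiff H S, Set.infinite_union] at hinf
    rcases hinf with hinf | hinf
    · obtain ⟨x, hx, y, hy, hxy, h⟩ := hr2 _ Set.inter_subset_right hinf
      exact ⟨x, hx.1, y, hy.1, hxy, .inl ⟨hx.2, hy.2, h⟩⟩
    · obtain ⟨x, hx, y, hy, hxy, h⟩ :=
        ht2 _ (fun x hx => (hH hx.1).resolve_left hx.2) hinf
      exact ⟨x, hx.1, y, hy.1, hxy, .inr ⟨hx.2, hy.2, h⟩⟩

/-- `ω`-sums and `ω*`-sums of countable `ℤ`-avoidable sets are `ℤ`-avoidable. -/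
theorem of_fibers [Countable L] (m : L → ℕ) (hm : MonotoneOn m S ∨ AntitoneOn m S)
    (hS : ∀ n, IntAvoidable {x ∈ S | m x = n}) : IntAvoidable S := by
  obtain ⟨i, hi⟩ := exists_injective_nat L
  choose r hr1 hr2 using hS
  refine ⟨fun x y => (m x = m y ∧ r (m x) x y) ∨ (m x < m y ∧ i x ≤ m y) ∨
    (m y < m x ∧ i y ≤ m x), ?_, ?_⟩
  · intro e he
    by_contra! hred
    have hle : ∀ a b, m (e b) ≤ m (e a) := by
      intro a b
      by_contra! hlt
      have hsub : {k | m (e k) ≤ m (e a)}.Infinite := by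
        rcases hm with hm | hm
        · exact (Set.Iic_infinite a).mono fun k hk => hm (he k) (he a) (e.monotone hk)
        · exact (Set.Ici_infinite a).mono fun k hk => hm (he a) (he k) (e.monotone hk)
      refine hsub (Set.Finite.of_finite_image (f := fun k => i (e k))
        ((Set.finite_Iic (m (e b))).subset ?_) (hi.comp e.injective).injOn)
      rintro _ ⟨k, hk, rfl⟩
      have hk' : m (e k) ≤ m (e a) := hk
      change i (e k) ≤ m (e b)
      rcases lt_trichotomy k b with h | rfl | h
      · have := hred k b h
        omega
      · omega
      · have := hred b k h
        omega
    have hconst : ∀ a, m (e a) = m (e 0) := fun a => le_antisymm (hle _ _) (hle _ _)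
    obtain ⟨a, b, hab, hn⟩ := hr1 (m (e 0)) e fun a => ⟨he a, hconst a⟩
    have := hred a b hab
    simp [hconst a, hconst b, hn] at this
  · intro H hH hinf
    by_cases hfib : ∃ n, {x ∈ H | m x = n}.Infinite
    · obtain ⟨n, hn⟩ := hfib
      obtain ⟨x, hx, y, hy, hxy, h⟩ := hr2 n _ (fun x hx => ⟨hH hx.1, hx.2⟩) hn
      exact ⟨x, hx.1, y, hy.1, hxy, .inl ⟨hx.2.trans hy.2.symm, hx.2.symm ▸ h⟩⟩
    · simp only [not_exists, Set.not_infinite] at hfib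
      obtain ⟨u, hu⟩ := hinf.nonempty
      obtain ⟨v, hv, hlt⟩ : ∃ v ∈ H, max (m u) (i u) < m v := by
        by_contra! hb
        refine hinf (((Set.finite_Iic (max (m u) (i u))).biUnion fun n _ => hfib n).subset ?_)
        intro x hx
        exact Set.mem_biUnion (hb x hx) ⟨hx, rfl⟩
      rw [max_lt_iff] at hlt
      rcases lt_trichotomy u v with h | rfl | h
      · exact ⟨u, hu, v, hv, h, .inr (.inl ⟨hlt.1, hlt.2.le⟩)⟩
      · exact (lt_irrefl _ hlt.1).elim
      · exact ⟨v, hv, u, hu, h, .inr (.inr ⟨hlt.1, hlt.2.le⟩)⟩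

theorem of_uIcc_of_subset [Countable L] (x : L) (hx : S ⊆ Set.Ici x ∨ S ⊆ Set.Iic x)
    (hS : ∀ y ∈ S, IntAvoidable (Set.uIcc x y)) : IntAvoidable S := by
  obtain ⟨i, hi⟩ := exists_injective_nat L
  let m : L → ℕ := fun z => sInf {n | ∃ p ∈ S, i p = n ∧ z ∈ Set.uIcc x p}
  have hmem : ∀ z ∈ S, ∃ p ∈ S, i p = m z ∧ z ∈ Set.uIcc x p := fun z hz =>
    Nat.sInf_mem (s := {n | ∃ p ∈ S, i p = n ∧ z ∈ Set.uIcc x p})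
      ⟨i z, z, hz, rfl, Set.right_mem_uIcc⟩
  have hle : ∀ z, ∀ w ∈ S, z ∈ Set.uIcc x w → m z ≤ m w := by
    intro z w hw hz
    obtain ⟨p, hp, hpm, hwp⟩ := hmem w hw
    exact Nat.sInf_le ⟨p, hp, hpm, Set.uIcc_subset_uIcc Set.left_mem_uIcc hwp hz⟩
  refine of_fibers m ?_ fun n => ?_
  · refine hx.imp (fun hx z hz w hw hzw => ?_) (fun hx z hz w hw hzw => ?_)
    · exact hle z w hw (Set.mem_uIcc_of_le (hx hz) hzw)
    · exact hle w z hz (Set.mem_uIcc_of_ge hzw (hx hw))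
  · rcases Set.eq_empty_or_nonempty {z ∈ S | m z = n} with h | ⟨w, hw, rfl⟩
    · exact h ▸ of_finite Set.finite_empty
    · obtain ⟨p, hp, hpm, -⟩ := hmem w hw
      refine (hS p hp).mono ?_
      rintro z ⟨hz, hzw⟩
      obtain ⟨q, -, hqm, hzq⟩ := hmem z hz
      rwa [hi (hqm.trans (hzw.trans hpm.symm))] at hzq

theorem of_uIcc [Countable L] (x : L) (hS : ∀ y ∈ S, IntAvoidable (Set.uIcc x y)) :
    IntAvoidable S := by
  have hup := of_uIcc_of_subset (S := S ∩ Set.Ici x) x (.inl Set.inter_subset_right)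
    fun y hy => hS y hy.1
  have hdown := of_uIcc_of_subset (S := S ∩ Set.Iic x) x (.inr Set.inter_subset_right)
    fun y hy => hS y hy.1
  exact (hup.union hdown).mono fun y hy => (le_total x y).imp (⟨hy, ·⟩) (⟨hy, ·⟩)

/-- The condensation identifying two points when the interval between them is `ℤ`-avoidable. -/
def condensation (L : Type*) [LinearOrder L] : Setoid L where
  r := fun x y => IntAvoidable (Set.uIcc x y)
  iseqv :=
    { refl := fun x => of_finite (by simp)
      symm := fun {x y} h => Set.uIcc_comm x y ▸ h
      trans := fun {x y z} h h1 => (h.union h1).mono Set.uIcc_subset_uIcc_union_uIcc }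

/-- A set of representatives of the condensation. -/
def representatives (L : Type*) [LinearOrder L] : Set L :=
  Set.range (Quotient.out : Quotient (condensation L) → L)

theorem exists_representative (x : L) :
    ∃ z ∈ representatives L, IntAvoidable (Set.uIcc z x) :=
  ⟨_, ⟨Quotient.mk (condensation L) x, rfl⟩, Quotient.mk_out (s := condensation L) x⟩

theorem eq_of_mem_representatives {x y : L} (hx : x ∈ representatives L)
    (hy : y ∈ representatives L) (h : IntAvoidable (Set.uIcc x y)) : x = y := by
  obtain ⟨p, rfl⟩ := hx
  obtain ⟨q, rfl⟩ := hy
  exact congrArg _ (Quotient.out_equiv_out.1 h)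

theorem denselyOrdered_representatives [Countable L] : DenselyOrdered (representatives L) := by
  refine ⟨?_⟩
  rintro ⟨x, hx⟩ ⟨y, hy⟩ (hxy : x < y)
  have hnot : ¬ IntAvoidable (Set.uIcc x y) := fun h =>
    hxy.ne (eq_of_mem_representatives hx hy h)
  obtain ⟨z, hz, hxz, hyz⟩ : ∃ z ∈ Set.uIcc x y,
      ¬ IntAvoidable (Set.uIcc x z) ∧ ¬ IntAvoidable (Set.uIcc y z) := by
    by_contra! hall
    have hX : IntAvoidable {z | IntAvoidable (Set.uIcc x z)} := of_uIcc x fun _ => id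
    have hY : IntAvoidable {z | IntAvoidable (Set.uIcc y z)} := of_uIcc y fun _ => id
    exact hnot ((hX.union hY).mono fun z hz => or_iff_not_imp_left.2 (hall z hz))
  rw [Set.uIcc_of_le hxy.le] at hz
  obtain ⟨w, hw, hwz⟩ := exists_representative z
  refine ⟨⟨w, hw⟩, ?_, ?_⟩
  · refine lt_of_not_ge fun h : w ≤ x => hxz (hwz.mono ?_)
    exact Set.uIcc_subset_uIcc (Set.mem_uIcc_of_le h hz.1) Set.right_mem_uIcc
  · refine lt_of_not_ge fun h : y ≤ w => hyz (hwz.mono ?_)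
    exact Set.uIcc_subset_uIcc (Set.mem_uIcc_of_ge hz.2 h) Set.right_mem_uIcc

theorem univ_of_isEmpty_rat_embedding [Countable L] (hL : IsEmpty (ℚ ↪o L)) :
    IntAvoidable (Set.univ : Set L) := by
  have := denselyOrdered_representatives (L := L)
  have hsub : Subsingleton (representatives L) := by
    by_contra hns
    rw [not_subsingleton_iff_nontrivial] at hns
    obtain ⟨f⟩ := Order.embedding_from_countable_to_dense ℚ (representatives L)
    exact hL.false (f.trans (OrderEmbedding.subtype _))
  rcases isEmpty_or_nonempty L with _ | ⟨⟨x⟩⟩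
  · exact of_finite Set.finite_univ
  · obtain ⟨z, hz, -⟩ := exists_representative x
    refine of_uIcc z fun y _ => ?_
    obtain ⟨w, hw, hwy⟩ := exists_representative y
    obtain rfl : w = z := congrArg Subtype.val
      (Subsingleton.elim (⟨w, hw⟩ : representatives L) ⟨z, hz⟩)
    exact hwy

end IntAvoidable


/-- **Erdős–Hajnal:** if `L` is a countable linear order with
`L → (ℤ, ℵ₀)²` — every 2-coloring of the pairs of `L` (red = `true`,
blue = `false`) contains a copy of `ℤ` all of whose pairs are red or an
infinite set all of whose pairs are blue — then `L` is not scattered, i.e.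
`L` contains a suborder isomorphic to `ℚ`. -/
theorem not_scattered_of_arrow_int_aleph0 {L : Type*} [LinearOrder L]
    [Countable L]
    (h : ∀ c : L → L → Bool,
      (∃ e : ℤ ↪o L, ∀ a b : ℤ, a < b → c (e a) (e b) = true) ∨
      (∃ H : Set L, H.Infinite ∧ ∀ x ∈ H, ∀ y ∈ H, x < y → c x y = false)) :
    Nonempty (ℚ ↪o L) := by
  by_contra hL
  obtain ⟨r, hr1, hr2⟩ := IntAvoidable.univ_of_isEmpty_rat_embedding (not_nonempty_iff.1 hL)
  classical
  rcases h fun x y => decide (r x y) with ⟨e, he⟩ | ⟨H, hH, hblue⟩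
  · obtain ⟨a, b, hab, hn⟩ := hr1 e fun _ => Set.mem_univ _
    exact hn (of_decide_eq_true (he a b hab))
  · obtain ⟨x, hx, y, hy, hxy, hred⟩ := hr2 H (Set.subset_univ H) hH
    exact of_decide_eq_false (hblue x hx y hy hxy) hred
end
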